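/- arXiv:math-ph/0610046 — 3 statements merged into one kernel-verified Lean document; each statement's English description precedes it below -/
import Mathlib

section
/- Let a > 0 be a real number. The double series χ(s) = ∑_{m=1}^∞ ∑_{n=1}^∞ n·(a m + n)^{-s} converges absolutely for Re(s) > 3, and every analytic continuation f of this series to the point 0 satisfies f(0) = 1/24 (in particular the value is independent of a). -/
/-- `f` is an analytic continuation to `s₀` of the function `F` given (by an absolutely
convergent series) on the half-plane `{s : Re s > c}`. -/
def IsContinuationAt (F : ℂ → ℂ) (c : ℝ) (s₀ : ℂ) (f : ℂ → ℂ) : Prop :=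
  ∃ U : Set ℂ, IsOpen U ∧ IsConnected U ∧ s₀ ∈ U ∧ {s : ℂ | c < s.re} ⊆ U ∧
    AnalyticOnNhd ℂ f U ∧ ∀ s : ℂ, c < s.re → f s = F s

open Filter Topology Asymptotics Set MeasureTheory

lemma summable_linear_form_rpow {a σ : ℝ} (ha : 0 < a) (hσ : 3 < σ) :
    Summable fun p : ℕ × ℕ => ((p.2 : ℝ) + 1) / (a * (p.1 + 1) + (p.2 + 1)) ^ σ := by
  have h1 : Summable fun n : ℕ => ((n : ℝ) + 1) ^ (-((σ - 1) / 2)) := by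
    have := (summable_nat_add_iff 1).2
      (Real.summable_nat_rpow.2 (show -((σ - 1) / 2) < -1 by linarith))
    simpa using this
  have h2 := (h1.mul_of_nonneg h1 (fun n => by positivity) (fun n => by positivity)).mul_left
    (a ^ (-((σ - 1) / 2)))
  refine h2.of_nonneg_of_le (fun p => by positivity) fun p => ?_
  set m : ℝ := (p.1 : ℝ) + 1
  set n : ℝ := (p.2 : ℝ) + 1
  have hm : 0 < m := by positivity
  have hn : 0 < n := by positivity
  have hx : 0 < a * m + n := by positivity
  calc n / (a * m + n) ^ σ ≤ (a * m + n) / (a * m + n) ^ σ := by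
        gcongr
        nlinarith [mul_pos ha hm]
    _ = (a * m + n) ^ (1 - σ) := by rw [Real.rpow_sub hx, Real.rpow_one]
    _ = ((a * m + n) ^ 2) ^ (-((σ - 1) / 2)) := by
        rw [← Real.rpow_natCast, ← Real.rpow_mul hx.le]
        congr 1
        push_cast
        ring
    _ ≤ (a * (m * n)) ^ (-((σ - 1) / 2)) := by
        apply Real.rpow_le_rpow_of_nonpos (by positivity)
        · nlinarith [mul_pos (mul_pos ha hm) hn, sq_nonneg (a * m), sq_nonneg n]
        · linarith
    _ = _ := by
        rw [Real.mul_rpow ha.le (by positivity), Real.mul_rpow hm.le hn.le]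

lemma hasMellin_exp_neg_mul_sum (c : ℕ → ℝ) (N : ℕ) {z : ℂ} (hz : 0 < z.re) :
    HasMellin (fun t : ℝ => ((Real.exp (-t) * ∑ j ∈ Finset.range N, c j * t ^ j : ℝ) : ℂ)) z
      (∑ j ∈ Finset.range N, (c j : ℂ) * Complex.Gamma (z + j)) := by
  have hmono (j : ℕ) : HasMellin (fun t : ℝ => (t : ℂ) ^ (j : ℂ) • ((Real.exp (-t) : ℝ) : ℂ)) z
      (Complex.Gamma (z + j)) := by
    have hj : 0 < (z + j).re := by simp; positivity
    refine ⟨MellinConvergent.cpow_smul.2 ?_, ?_⟩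
    · simpa [MellinConvergent, mul_comm] using! Complex.GammaIntegral_convergent hj
    · rw [mellin_cpow_smul, ← Complex.GammaIntegral_eq_mellin, Complex.Gamma_eq_integral hj]
  induction N with
  | zero => simp [HasMellin, MellinConvergent, mellin]
  | succ N ih =>
    have h1 := hasMellin_const_smul (hmono N).1 (c N : ℂ)
    have h2 := hasMellin_add ih.1 h1.1
    rw [ih.2, h1.2, (hmono N).2] at h2
    convert h2 using 1
    · ext t
      rw [Finset.sum_range_succ]
      simp [Complex.cpow_natCast]
      ring
    · rw [Finset.sum_range_succ, smul_eq_mul]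

lemma exists_mellin_continuation {ψ : ℝ → ℝ} {c : ℕ → ℝ} {N k : ℕ}
    (hψ : ContinuousOn ψ (Ioi 0)) (htop : ψ =O[atTop] fun t => t ^ k)
    (hzero : (fun t => ψ t - ∑ j ∈ Finset.range N, c j * t ^ j) =O[𝓝[>] 0] fun t => t ^ N) :
    ∃ h : ℂ → ℂ, (∀ z : ℂ, -(N : ℝ) < z.re → DifferentiableAt ℂ h z) ∧
      ∀ z : ℂ, 0 < z.re → mellin (fun t : ℝ => ((Real.exp (-t) * ψ t : ℝ) : ℂ)) z =
        (∑ j ∈ Finset.range N, (c j : ℂ) * Complex.Gamma (z + j)) + h z := by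
  set P : ℝ → ℝ := fun t => ∑ j ∈ Finset.range N, c j * t ^ j with hP
  set R : ℝ → ℂ := fun t => ((Real.exp (-t) * (ψ t - P t) : ℝ) : ℂ) with hR
  have hloc : LocallyIntegrableOn R (Ioi 0) := by
    refine ContinuousOn.locallyIntegrableOn ?_ measurableSet_Ioi
    refine Complex.continuous_ofReal.comp_continuousOn ?_
    fun_prop
  have hpow (j : ℕ) : (fun t : ℝ => t ^ j) =O[atTop] fun t => Real.exp (1 / 2 * t) :=
    (isLittleO_pow_exp_pos_mul_atTop j (by norm_num)).isBigO
  have hRtop : R =O[atTop] fun t => Real.exp (-(1 / 2) * t) := by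
    have h1 : (fun t => ψ t - P t) =O[atTop] fun t => Real.exp (1 / 2 * t) :=
      (htop.trans (hpow k)).sub (IsBigO.fun_sum fun j _ => (hpow j).const_mul_left _)
    have h2 := (isBigO_refl (fun t : ℝ => Real.exp (-t)) atTop).mul h1
    refine (Complex.isBigO_ofReal_left.2 h2).congr_right fun t => ?_
    rw [← Real.exp_add]
    congr 1
    ring
  have hRzero : R =O[𝓝[>] 0] fun t => t ^ (-(-(N : ℝ))) := by
    have h1 : (fun t : ℝ => Real.exp (-t)) =O[𝓝[>] 0] fun _ => (1 : ℝ) :=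
      ((by fun_prop : Continuous fun t : ℝ => Real.exp (-t)).tendsto 0).isBigO_one ℝ
        |>.mono nhdsWithin_le_nhds
    refine (Complex.isBigO_ofReal_left.2 (h1.mul hzero)).congr_right fun t => ?_
    simp
  refine ⟨mellin R, fun z hz => mellin_differentiableAt_of_isBigO_rpow_exp (by norm_num) hloc
    hRtop hRzero hz, fun z hz => ?_⟩
  have hRconv : MellinConvergent R z :=
    mellinConvergent_of_isBigO_rpow_exp (a := 1 / 2) (by norm_num) hloc hRtop hRzero
      (lt_of_le_of_lt (by simp) hz)
  have hPm := hasMellin_exp_neg_mul_sum c N hz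
  rw [← hPm.2, ← (hasMellin_add hPm.1 hRconv).2]
  congr 1
  ext t
  simp only [hR, hP]
  push_cast
  ring

lemma eqOn_re_gt_of_eqOn_re_gt {f g : ℂ → ℂ} {c d : ℝ}
    (hf : ∀ s : ℂ, d < s.re → DifferentiableAt ℂ f s)
    (hg : ∀ s : ℂ, d < s.re → DifferentiableAt ℂ g s)
    (hfg : ∀ s : ℂ, c < s.re → f s = g s) {s : ℂ} (hs : d < s.re) : f s = g s := by
  have hopen (r : ℝ) : IsOpen {s : ℂ | r < s.re} := isOpen_lt continuous_const Complex.continuous_re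
  have hf' : AnalyticOnNhd ℂ f {s : ℂ | d < s.re} :=
    DifferentiableOn.analyticOnNhd (fun s hs => (hf s hs).differentiableWithinAt) (hopen d)
  have hg' : AnalyticOnNhd ℂ g {s : ℂ | d < s.re} :=
    DifferentiableOn.analyticOnNhd (fun s hs => (hg s hs).differentiableWithinAt) (hopen d)
  have hconn : IsPreconnected {s : ℂ | d < s.re} :=
    ((convex_Ioi d).linear_preimage Complex.reLm).isPreconnected
  refine hf'.eqOn_of_preconnected_of_eventuallyEq hg' hconn
    (z₀ := ((max c d + 1 : ℝ) : ℂ)) ?_ ?_ hs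
  · simp only [mem_ofPred_eq, Complex.ofReal_re]
    linarith [le_max_right c d]
  · filter_upwards [(hopen c).mem_nhds (x := ((max c d + 1 : ℝ) : ℂ)) (by
      simp only [mem_ofPred_eq, Complex.ofReal_re]
      linarith [le_max_left c d])] with z hz using hfg z hz

lemma exists_differentiable_of_forall_half_plane {F : ℂ → ℂ} {c : ℝ}
    (h : ∀ N : ℕ, ∃ H : ℂ → ℂ, (∀ s : ℂ, c - N < s.re → DifferentiableAt ℂ H s) ∧
      ∀ s : ℂ, c < s.re → H s = F s) :
    ∃ G : ℂ → ℂ, Differentiable ℂ G ∧ ∀ s : ℂ, c < s.re → G s = F s := by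
  choose H hd he using h
  choose N hN using fun s : ℂ => exists_nat_gt (c - s.re)
  have key (M : ℕ) (s : ℂ) (hs : c - M < s.re) : H (N s) s = H M s := by
    refine eqOn_re_gt_of_eqOn_re_gt (c := c) (d := max (c - N s) (c - M))
      (fun z hz => hd _ z ((le_max_left _ _).trans_lt hz))
      (fun z hz => hd _ z ((le_max_right _ _).trans_lt hz))
      (fun z hz => (he _ z hz).trans (he _ z hz).symm) (max_lt ?_ hs)
    linarith [hN s]
  refine ⟨fun s => H (N s) s, fun s => ?_, fun s hs => he _ s hs⟩
  have hs : c - N s < s.re := by linarith [hN s]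
  refine (hd (N s) s hs).congr_of_eventuallyEq ?_
  filter_upwards [(isOpen_lt continuous_const Complex.continuous_re).mem_nhds hs] with z hz
  exact key _ z hz

/-- The function `(exp t - 1) / t`, extended by `1` at `0`. -/
noncomputable def expSlope : ℝ → ℝ := dslope Real.exp 0

lemma expSlope_of_ne_zero {t : ℝ} (ht : t ≠ 0) : expSlope t = (Real.exp t - 1) / t := by
  rw [expSlope, dslope_of_ne _ ht, slope_def_field]
  simp

lemma expSlope_pos (t : ℝ) : 0 < expSlope t := by
  rcases lt_trichotomy t 0 with ht | rfl | ht
  · rw [expSlope_of_ne_zero ht.ne]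
    exact div_pos_of_neg_of_neg (by simpa using ht) ht
  · simp [expSlope, dslope_same]
  · rw [expSlope_of_ne_zero ht.ne']
    exact div_pos (by simpa using ht) ht

lemma continuous_expSlope : Continuous expSlope := by
  rw [← continuousOn_univ, expSlope, continuousOn_dslope univ_mem]
  exact ⟨Real.continuous_exp.continuousOn, Real.differentiableAt_exp⟩

lemma analyticAt_expSlope_zero : AnalyticAt ℝ expSlope 0 := by
  obtain ⟨p, hp⟩ := (analyticAt_rexp : AnalyticAt ℝ Real.exp 0)
  exact ⟨_, hp.has_fpower_series_dslope_fslope⟩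

lemma expSlope_sub_isBigO :
    (fun t => expSlope t - (1 + t / 2 + t ^ 2 / 6 + t ^ 3 / 24)) =O[𝓝[≠] 0] fun t => t ^ 4 := by
  have h := ((Real.exp_sub_sum_range_isBigO_pow 5).mono nhdsWithin_le_nhds).mul
    (isBigO_refl (fun t : ℝ => t⁻¹) (𝓝[≠] 0))
  refine h.congr' ?_ ?_ <;> filter_upwards [self_mem_nhdsWithin] with t ht
  · have ht : t ≠ 0 := ht
    rw [expSlope_of_ne_zero ht]
    simp only [Finset.sum_range_succ, Finset.sum_range_zero, Nat.factorial]
    field_simp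
    push_cast
    ring
  · have ht : t ≠ 0 := ht
    field_simp

lemma inv_expSlope_sub_isBigO :
    (fun t => (expSlope t)⁻¹ - (1 - t / 2 + t ^ 2 / 12)) =O[𝓝[≠] 0] fun t => t ^ 4 := by
  have hinv : Continuous fun t => (expSlope t)⁻¹ :=
    continuous_expSlope.inv₀ fun t => (expSlope_pos t).ne'
  have hq : Continuous fun t : ℝ => 1 - t / 2 + t ^ 2 / 12 := by fun_prop
  have hr : Continuous fun t : ℝ => 1 / 144 - t / 288 := by fun_prop
  have bdd {f : ℝ → ℝ} (hf : Continuous f) : f =O[𝓝[≠] 0] fun _ => (1 : ℝ) :=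
    ((hf.tendsto 0).isBigO_one ℝ).mono nhdsWithin_le_nhds
  have h1 := (bdd hr).mul (isBigO_refl (fun t : ℝ => t ^ 4) (𝓝[≠] 0))
  have h2 := (bdd hq).mul expSlope_sub_isBigO
  refine ((bdd hinv).mul (h1.sub h2)).congr
    (fun t => ?_) (fun t => by ring)
  have := (expSlope_pos t).ne'
  field_simp
  ring

/-- The function `t ^ 3 / ((exp (a t) - 1) * (1 - exp (-t)) ^ 2)`, extended continuously to `0`. -/
noncomputable def mellinKernel (a t : ℝ) : ℝ :=
  a⁻¹ * (expSlope (a * t))⁻¹ * (expSlope (-t))⁻¹ ^ 2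

lemma continuous_mellinKernel (a : ℝ) : Continuous (mellinKernel a) := by
  have hinv : Continuous fun t => (expSlope t)⁻¹ :=
    continuous_expSlope.inv₀ fun t => (expSlope_pos t).ne'
  unfold mellinKernel
  exact (continuous_const.mul (hinv.comp (by fun_prop))).mul ((hinv.comp (by fun_prop)).pow 2)

lemma mellinKernel_isBigO_atTop {a : ℝ} (ha : 0 < a) :
    mellinKernel a =O[atTop] fun t => t ^ 2 := by
  refine IsBigO.of_bound (4 * a⁻¹) ?_
  filter_upwards [eventually_ge_atTop 1] with t ht
  have h0 : 0 < t := by linarith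
  have h1 : (expSlope (a * t))⁻¹ ≤ 1 := by
    refine inv_le_one_of_one_le₀ ?_
    rw [expSlope_of_ne_zero (by positivity), le_div_iff₀ (by positivity)]
    linarith [Real.add_one_le_exp (a * t)]
  have h2 : (expSlope (-t))⁻¹ ≤ 1 + t := by
    refine inv_le_of_inv_le₀ (by positivity) ?_
    have h3 : Real.exp (-t) ≤ (1 + t)⁻¹ := by
      rw [Real.exp_neg]
      exact inv_anti₀ (by positivity) (by linarith [Real.add_one_le_exp t])
    rw [expSlope_of_ne_zero (by linarith), le_div_iff_of_neg (by linarith)]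
    have h4 : (1 + t)⁻¹ * (1 + t) = 1 := inv_mul_cancel₀ (by positivity)
    linarith
  have p1 := expSlope_pos (a * t)
  have p2 := expSlope_pos (-t)
  have hpos : 0 ≤ mellinKernel a t := by unfold mellinKernel; positivity
  rw [Real.norm_of_nonneg hpos, Real.norm_of_nonneg (by positivity)]
  calc mellinKernel a t ≤ a⁻¹ * 1 * (1 + t) ^ 2 := by unfold mellinKernel; gcongr
    _ ≤ a⁻¹ * 1 * (2 * t) ^ 2 := by gcongr; linarith
    _ = 4 * a⁻¹ * t ^ 2 := by ring

lemma exists_mellinKernel_expansion (a : ℝ) (N : ℕ) : ∃ c : ℕ → ℝ,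
    (fun t => mellinKernel a t - ∑ j ∈ Finset.range N, c j * t ^ j) =O[𝓝[>] 0]
      fun t => t ^ N := by
  have h1 : AnalyticAt ℝ (fun t : ℝ => expSlope (a * t)) 0 :=
    AnalyticAt.fun_comp (by simpa using analyticAt_expSlope_zero) (by fun_prop)
  have h2 : AnalyticAt ℝ (fun t : ℝ => expSlope (-t)) 0 :=
    AnalyticAt.fun_comp (by simpa using analyticAt_expSlope_zero) (by fun_prop)
  have h3 : AnalyticAt ℝ (mellinKernel a) 0 :=
    (analyticAt_const.mul (h1.inv (expSlope_pos _).ne')).mul ((h2.inv (expSlope_pos _).ne').pow 2)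
  obtain ⟨p, hp⟩ := h3
  refine ⟨p.coeff, ((hp.isBigO_sub_partialSum_pow N).mono nhdsWithin_le_nhds).congr'
    (.of_forall fun t => ?_) ?_⟩
  · simp [FormalMultilinearSeries.partialSum, mul_comm]
  · filter_upwards [self_mem_nhdsWithin] with t ht
    rw [Real.norm_of_nonneg (le_of_lt ht)]

/-- The Taylor coefficients of `mellinKernel a` of order at most `3`. -/
noncomputable def mellinKernelCoeff (a : ℝ) (j : ℕ) : ℝ :=
  match j with
  | 0 => a⁻¹
  | 1 => a⁻¹ - 1 / 2
  | 2 => 5 / 12 * a⁻¹ - 1 / 2 + a / 12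
  | 3 => a⁻¹ / 12 - 5 / 24 + a / 12
  | _ => 0

lemma mellinKernel_expansion_four {a : ℝ} (ha : 0 < a) :
    (fun t => mellinKernel a t - ∑ j ∈ Finset.range 4, mellinKernelCoeff a j * t ^ j)
      =O[𝓝[>] 0] fun t => t ^ 4 := by
  have bdd {f : ℝ → ℝ} (hf : Continuous f) : f =O[𝓝[>] 0] fun _ => (1 : ℝ) :=
    ((hf.tendsto 0).isBigO_one ℝ).mono nhdsWithin_le_nhds
  have hinv : Continuous fun t => (expSlope t)⁻¹ :=
    continuous_expSlope.inv₀ fun t => (expSlope_pos t).ne'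
  have dil {b : ℝ} (hb : b ≠ 0) : (fun t => (expSlope (b * t))⁻¹ -
      (1 - (b * t) / 2 + (b * t) ^ 2 / 12)) =O[𝓝[>] 0] fun t => t ^ 4 := by
    have hlim : Tendsto (fun t => b * t) (𝓝[>] 0) (𝓝[≠] 0) := by
      refine tendsto_nhdsWithin_iff.2 ⟨?_, ?_⟩
      · exact ((continuous_const_mul b).tendsto' 0 0 (mul_zero b)).mono_left nhdsWithin_le_nhds
      · filter_upwards [self_mem_nhdsWithin] with t ht
        exact mul_ne_zero hb (ne_of_gt ht)
    refine (inv_expSlope_sub_isBigO.comp_tendsto hlim).trans ?_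
    refine ((isBigO_refl (fun t : ℝ => t ^ 4) (𝓝[>] 0)).const_mul_left (b ^ 4)).congr_left
      fun t => ?_
    simp [mul_pow]
  have hE1 := dil ha.ne'
  have hE2 := dil (b := -1) (by norm_num)
  have hc1 : Continuous fun t => a⁻¹ * (expSlope (-1 * t))⁻¹ ^ 2 :=
    continuous_const.mul ((hinv.comp (by fun_prop)).pow 2)
  have hc2 : Continuous fun t => a⁻¹ * (1 - (a * t) / 2 + (a * t) ^ 2 / 12) *
      ((expSlope (-1 * t))⁻¹ + (1 - (-1 * t) / 2 + (-1 * t) ^ 2 / 12)) :=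
    (by fun_prop : Continuous fun t : ℝ => a⁻¹ * (1 - (a * t) / 2 + (a * t) ^ 2 / 12)).mul
      ((hinv.comp (by fun_prop)).add (by fun_prop))
  have hc3 : Continuous fun t : ℝ => a⁻¹ * ((1 / 144 - a / 24 + 5 * a ^ 2 / 144) +
      (-a / 288 + a ^ 2 / 144) * t + a ^ 2 / 1728 * t ^ 2) := by fun_prop
  refine ((((bdd hc1).mul hE1).add ((bdd hc2).mul hE2)).add
    ((bdd hc3).mul (isBigO_refl (fun t : ℝ => t ^ 4) (𝓝[>] 0)))).congr
    (fun t => ?_) (fun t => by ring)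
  simp only [Finset.sum_range_succ, Finset.sum_range_zero, mellinKernelCoeff, mellinKernel,
    neg_one_mul]
  field_simp
  ring

lemma hasSum_mellinKernel {a t : ℝ} (ha : 0 < a) (ht : 0 < t) :
    HasSum (fun p : ℕ × ℕ => ((p.2 : ℝ) + 1) * Real.exp (-(a * (p.1 + 1) + (p.2 + 1)) * t))
      ((t ^ 3)⁻¹ * (Real.exp (-t) * mellinKernel a t)) := by
  set r := Real.exp (-(a * t)) with hr
  set q := Real.exp (-t) with hq
  have hr0 : 0 < r := Real.exp_pos _
  have hq0 : 0 < q := Real.exp_pos _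
  have hr1 : r < 1 := Real.exp_lt_one_iff.2 (by nlinarith [mul_pos ha ht])
  have hq1 : q < 1 := Real.exp_lt_one_iff.2 (by linarith)
  have h1 : HasSum (fun m : ℕ => r ^ (m + 1)) (r * (1 - r)⁻¹) := by
    simpa [pow_succ'] using (hasSum_geometric_of_lt_one hr0.le hr1).mul_left r
  have h2 : HasSum (fun n : ℕ => ((n : ℝ) + 1) * q ^ (n + 1)) (q / (1 - q) ^ 2) := by
    have hq' : ‖q‖ < 1 := by rwa [Real.norm_of_nonneg hq0.le]
    have := hasSum_coe_mul_geometric_of_norm_lt_one hq'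
    rw [← hasSum_nat_add_iff' 1] at this
    simpa using this
  have h3 := h1.mul h2 (h1.summable.mul_of_nonneg h2.summable (fun m => by positivity)
    (fun n => by positivity))
  convert! h3 using 1
  · funext p
    rw [hr, hq, ← Real.exp_nat_mul, ← Real.exp_nat_mul, mul_left_comm, ← Real.exp_add]
    push_cast
    ring_nf
  · have hat : 0 < a * t := mul_pos ha ht
    have e1 : Real.exp (a * t) = r⁻¹ := by rw [hr, Real.exp_neg, inv_inv]
    rw [mellinKernel, expSlope_of_ne_zero hat.ne', expSlope_of_ne_zero (by linarith), e1, ← hq]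
    have n1 : 1 - r ≠ 0 := by linarith
    have n2 : 1 - q ≠ 0 := by linarith
    have n3 : q - 1 ≠ 0 := by linarith
    have n4 : r⁻¹ - 1 ≠ 0 := by
      rw [sub_ne_zero]; exact (one_lt_inv₀ hr0 |>.2 hr1).ne'
    have n5 : r⁻¹ - 1 = (1 - r) / r := by field_simp
    rw [n5]
    field_simp
    ring

lemma hasSum_mellin_mellinKernel {a : ℝ} (ha : 0 < a) {s : ℂ} (hs : 3 < s.re) :
    HasSum (fun p : ℕ × ℕ => Complex.Gamma s * (((p.2 : ℂ) + 1) *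
        ((a : ℂ) * (p.1 + 1) + ((p.2 : ℂ) + 1)) ^ (-s)))
      (mellin (fun t : ℝ => ((Real.exp (-t) * mellinKernel a t : ℝ) : ℂ)) (s - 3)) := by
  have h := hasSum_mellin (ι := ℕ × ℕ) (a := fun p => (p.2 : ℂ) + 1)
    (p := fun p => a * (p.1 + 1) + (p.2 + 1)) (s := s)
    (F := fun t : ℝ => (t : ℂ) ^ (-3 : ℂ) • ((Real.exp (-t) * mellinKernel a t : ℝ) : ℂ))
    (fun p => Or.inr (by positivity)) (by linarith) (fun t ht => ?_) ?_
  · rw [mellin_cpow_smul, ← sub_eq_add_neg] at h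
    refine h.congr_fun fun p => ?_
    rw [Complex.cpow_neg]
    push_cast
    ring
  · have := Complex.hasSum_ofReal.2 (hasSum_mellinKernel ha ht)
    convert this using 1
    · ext p
      push_cast
      ring
    · rw [Complex.cpow_neg, show (3 : ℂ) = ((3 : ℕ) : ℂ) by norm_num, Complex.cpow_natCast]
      push_cast
      rfl
  · refine (summable_linear_form_rpow ha hs).congr fun p => ?_
    rw [show (p.2 : ℂ) + 1 = ((p.2 + 1 : ℝ) : ℂ) by push_cast; rfl, Complex.norm_real,
      Real.norm_of_nonneg (by positivity)]

lemma summable_norm_linear_form_cpow {a : ℝ} (ha : 0 < a) {s : ℂ} (hs : 3 < s.re) :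
    Summable (fun p : ℕ × ℕ =>
      ‖((p.2 : ℂ) + 1) * ((a : ℂ) * (p.1 + 1) + ((p.2 : ℂ) + 1)) ^ (-s)‖) := by
  refine (summable_linear_form_rpow ha hs).congr fun p => ?_
  rw [show (p.2 : ℂ) + 1 = ((p.2 + 1 : ℝ) : ℂ) by push_cast; rfl, norm_mul, Complex.norm_real,
    Real.norm_of_nonneg (by positivity),
    show (a : ℂ) * (p.1 + 1) + ((p.2 + 1 : ℝ) : ℂ) = ((a * (p.1 + 1) + (p.2 + 1) : ℝ) : ℂ) by
      push_cast; rfl,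
    Complex.norm_cpow_eq_rpow_re_of_pos (by positivity), Complex.neg_re,
    Real.rpow_neg (by positivity), div_eq_mul_inv]

/-- The double zeta series `∑_{m,n≥1} n (am+n)^{-s}`. -/
noncomputable def linearFormZeta (a : ℝ) (s : ℂ) : ℂ :=
  ∑' (m : ℕ) (n : ℕ), ((n : ℂ) + 1) * ((a : ℂ) * (m + 1) + ((n : ℂ) + 1)) ^ (-s)

lemma Gamma_mul_linearFormZeta {a : ℝ} (ha : 0 < a) {s : ℂ} (hs : 3 < s.re) :
    Complex.Gamma s * linearFormZeta a s =
      mellin (fun t : ℝ => ((Real.exp (-t) * mellinKernel a t : ℝ) : ℂ)) (s - 3) := by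
  rw [← (hasSum_mellin_mellinKernel ha hs).tsum_eq, tsum_mul_left, linearFormZeta,
    (summable_norm_linear_form_cpow ha hs).of_norm.tsum_prod]

lemma exists_linearFormZeta_continuation {a : ℝ} (ha : 0 < a) {N : ℕ} {c : ℕ → ℝ}
    (hc : (fun t => mellinKernel a t - ∑ j ∈ Finset.range N, c j * t ^ j) =O[𝓝[>] 0]
      fun t => t ^ N) :
    ∃ H : ℂ → ℂ, (∀ s : ℂ, 3 - (N : ℝ) < s.re → DifferentiableAt ℂ H s) ∧
      (∀ s : ℂ, 3 < s.re → H s = (s - 1) * (s - 2) * (s - 3) * linearFormZeta a s) ∧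
      H 0 = ∑ j ∈ Finset.range N, (c j : ℂ) * (ascPochhammer ℂ j).eval (-3) := by
  obtain ⟨h, hd, hm⟩ := exists_mellin_continuation (continuous_mellinKernel a).continuousOn
    (mellinKernel_isBigO_atTop ha) hc
  refine ⟨fun s => (∑ j ∈ Finset.range N, (c j : ℂ) * (ascPochhammer ℂ j).eval (s - 3)) +
    (s - 1) * (s - 2) * (s - 3) * (Complex.Gamma s)⁻¹ * h (s - 3), fun s hs => ?_,
    fun s hs => ?_, by simp [Complex.Gamma_zero]⟩
  · have h1 : DifferentiableAt ℂ (fun s => h (s - 3)) s :=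
      DifferentiableAt.comp (g := h) s (hd (s - 3) (by simp; linarith)) (by fun_prop)
    have h2 := Complex.differentiable_one_div_Gamma s
    have h3 (j : ℕ) : DifferentiableAt ℂ (fun s => (ascPochhammer ℂ j).eval (s - 3)) s :=
      DifferentiableAt.comp (g := fun z => (ascPochhammer ℂ j).eval z) s
        (ascPochhammer ℂ j).differentiableAt (by fun_prop)
    have h4 : DifferentiableAt ℂ (fun s : ℂ => (s - 1) * (s - 2) * (s - 3)) s := by fun_prop
    exact (DifferentiableAt.fun_sum fun j _ => (h3 j).const_mul _).add ((h4.mul h2).mul h1)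
  · have hre : 0 < (s - 3).re := by simp; linarith
    have hz : Complex.Gamma (s - 3) ≠ 0 := Complex.Gamma_ne_zero_of_re_pos hre
    have hs0 : Complex.Gamma s ≠ 0 := Complex.Gamma_ne_zero_of_re_pos (by linarith)
    have hne (k : ℕ) : s - 3 ≠ -k := fun hk => by
      rw [hk] at hre
      simp only [Complex.neg_re, Complex.natCast_re] at hre
      linarith [k.cast_nonneg (α := ℝ)]
    have hpoch (j : ℕ) := Complex.Gamma_add_nat_div_Gamma_eq (n := j) (s - 3) hne
    have hG : Complex.Gamma s = (s - 1) * (s - 2) * (s - 3) * Complex.Gamma (s - 3) := by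
      have := hpoch 3
      rw [div_eq_iff hz, show s - 3 + ((3 : ℕ) : ℂ) = s by push_cast; ring] at this
      have h3 : (ascPochhammer ℂ 3).eval (s - 3) = (s - 1) * (s - 2) * (s - 3) := by
        simp [ascPochhammer_succ_right]
        ring
      rw [this, h3]
    have key := Gamma_mul_linearFormZeta ha hs
    rw [hm _ hre] at key
    have hL : linearFormZeta a s = (Complex.Gamma s)⁻¹ *
        ((∑ j ∈ Finset.range N, (c j : ℂ) * Complex.Gamma (s - 3 + j)) + h (s - 3)) := by
      rw [← key, inv_mul_cancel_left₀ hs0]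
    have hfac : (s - 1) * (s - 2) * (s - 3) * (Complex.Gamma s)⁻¹ = (Complex.Gamma (s - 3))⁻¹ := by
      rw [hG] at hs0 ⊢
      rw [mul_inv, mul_inv_cancel_left₀ (mul_ne_zero_iff.1 hs0).1]
    rw [hL, ← mul_assoc, hfac, mul_add, Finset.mul_sum]
    refine congrArg₂ _ ?_ (by rw [hfac])
    refine Finset.sum_congr rfl fun j _ => ?_
    rw [← hpoch j]
    ring

lemma exists_entire_linearFormZeta {a : ℝ} (ha : 0 < a) :
    ∃ G : ℂ → ℂ, Differentiable ℂ G ∧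
      (∀ s : ℂ, 3 < s.re → G s = (s - 1) * (s - 2) * (s - 3) * linearFormZeta a s) ∧
      G 0 = -1 / 4 := by
  obtain ⟨G, hG, hGeq⟩ := exists_differentiable_of_forall_half_plane (c := 3)
    (F := fun s => (s - 1) * (s - 2) * (s - 3) * linearFormZeta a s) fun N => by
      obtain ⟨c, hc⟩ := exists_mellinKernel_expansion a N
      obtain ⟨H, hd, he, -⟩ := exists_linearFormZeta_continuation ha hc
      exact ⟨H, hd, he⟩
  obtain ⟨H, hd, he, h0⟩ := exists_linearFormZeta_continuation ha (mellinKernel_expansion_four ha)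
  refine ⟨G, hG, hGeq, ?_⟩
  rw [eqOn_re_gt_of_eqOn_re_gt (fun s _ => hG s) hd
    (fun s hs => (hGeq s hs).trans (he s hs).symm) (s := 0) (by norm_num), h0]
  have ha' : (a : ℂ) ≠ 0 := by exact_mod_cast ha.ne'
  simp [Finset.sum_range_succ, mellinKernelCoeff, ascPochhammer_succ_right]
  field_simp
  ring

/-- for `a > 0`, the double series `χ(s) = ∑_{m,n≥1} n·(am+n)^{-s}`
converges absolutely for `Re s > 3`, and every analytic continuation `f` of it to `0`
satisfies `f(0) = 1/24` (independently of `a`). -/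
theorem stmt14 (a : ℝ) (ha : 0 < a) :
    (∀ s : ℂ, 3 < s.re →
      Summable (fun p : ℕ × ℕ =>
        ‖((p.2 : ℂ) + 1) * ((a : ℂ) * (p.1 + 1) + ((p.2 : ℂ) + 1)) ^ (-s)‖)) ∧
    ∀ f : ℂ → ℂ,
      IsContinuationAt
        (fun s => ∑' (m : ℕ) (n : ℕ),
          ((n : ℂ) + 1) * ((a : ℂ) * (m + 1) + ((n : ℂ) + 1)) ^ (-s)) 3 0 f →
      f 0 = 1 / 24 := by
  refine ⟨fun s hs => summable_norm_linear_form_cpow ha hs, ?_⟩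
  rintro f ⟨U, -, hU, h0, hsub, hf, hfeq⟩
  obtain ⟨G, hG, hGeq, hG0⟩ := exists_entire_linearFormZeta ha
  have hpoly : AnalyticOnNhd ℂ (fun s : ℂ => (s - 1) * (s - 2) * (s - 3)) U :=
    fun s _ => by fun_prop
  have hopen : IsOpen {s : ℂ | (3 : ℝ) < s.re} := isOpen_lt continuous_const Complex.continuous_re
  have h4 : (4 : ℂ) ∈ {s : ℂ | (3 : ℝ) < s.re} := by
    simp only [mem_ofPred_eq]
    norm_num
  have h := (hpoly.mul hf).eqOn_of_preconnected_of_eventuallyEq (fun s _ => hG.analyticAt s)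
    hU.isPreconnected (hsub h4) (by
      filter_upwards [hopen.mem_nhds h4] with s hs
      rw [hGeq s hs]
      exact congrArg _ (hfeq s hs)) h0
  rw [hG0] at h
  beta_reduce at h
  linear_combination (-1 / 6) * h
end

section
/- The series Z(s) = ∑_{n=1}^∞ (2n+1)·(n(n+1))^{-s} converges absolutely for Re(s) > 2, and every analytic continuation f of this series to the point 0 satisfies f(0) = −2/3 and f'(0) = 4·ζ'(−1) − 1/2, where ζ' is the derivative of the Riemann zeta function. -/
lemma hasSum_half_integer_cpow {z : ℂ} (hz : 1 < z.re) :
    HasSum (fun n : ℕ => ((n : ℂ) + 3 / 2) ^ (-z)) ((2 ^ z - 1) * riemannZeta z - 2 ^ z) := by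
  set f : ℕ → ℂ := fun n => 1 / (n : ℂ) ^ z with hf
  have hs : Summable f := Complex.summable_one_div_nat_cpow.mpr hz
  have hev : Summable fun k => f (2 * k) :=
    hs.comp_injective (mul_right_injective₀ two_ne_zero)
  have hod : Summable fun k => f (2 * k + 1) :=
    hs.comp_injective ((add_left_injective 1).comp (mul_right_injective₀ two_ne_zero))
  have hsplit := tsum_even_add_odd hev hod
  have h2 : (2 : ℂ) ^ z ≠ 0 := by simp [Complex.cpow_eq_zero_iff]
  have hcp (a : ℝ) (ha : 0 ≤ a) : ((2 : ℂ) * a) ^ z = 2 ^ z * (a : ℂ) ^ z := by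
    have := Complex.mul_cpow_ofReal_nonneg (zero_le_two (α := ℝ)) ha z
    simpa using this
  have hev' : ∑' k, f (2 * k) = (2 ^ z)⁻¹ * riemannZeta z := by
    rw [zeta_eq_tsum_one_div_nat_cpow hz, ← tsum_mul_left]
    refine tsum_congr fun k => ?_
    have := hcp k (by positivity)
    simp only [hf]
    push_cast at this ⊢
    rw [this]
    field_simp
  have hterm (k : ℕ) : 2 ^ z * f (2 * k + 1) = ((k : ℂ) + 1 / 2) ^ (-z) := by
    have := hcp (k + 1 / 2) (by positivity)
    push_cast at this
    rw [Complex.cpow_neg, hf]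
    push_cast
    rw [show (2 * (k : ℂ) + 1) = 2 * (k + 1 / 2) by ring, this, one_div, mul_inv,
      mul_inv_cancel_left₀ h2]
  have hsum : HasSum (fun k : ℕ => ((k : ℂ) + 1 / 2) ^ (-z)) ((2 ^ z - 1) * riemannZeta z) := by
    have h := hod.hasSum.mul_left (2 ^ z)
    simp only [hterm] at h
    convert! h using 1
    have h3 : ∑' k, f (2 * k + 1) = riemannZeta z - (2 ^ z)⁻¹ * riemannZeta z := by
      rw [← hev', zeta_eq_tsum_one_div_nat_cpow hz, ← hsplit]
      ring
    rw [h3]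
    field_simp
  have h := (hasSum_nat_add_iff' 1).mpr hsum
  convert! h using 1
  · ext n
    congr 1
    push_cast
    ring
  · rw [Finset.sum_range_one, ← hterm 0]
    simp [hf]

/-- The completion of `(z - 1) * ∑ n, (n + 3 / 2) ^ (-z)` to an entire function. -/
noncomputable def halfZeta (z : ℂ) : ℂ := (2 ^ z - 1) * riemannZeta₁ z - (z - 1) * 2 ^ z

lemma differentiable_halfZeta : Differentiable ℂ halfZeta := by
  have h : Differentiable ℂ fun z : ℂ => (2 : ℂ) ^ z := fun z =>
    differentiableAt_id.const_cpow (Or.inl two_ne_zero)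
  unfold halfZeta
  fun_prop

lemma hasSum_halfZeta {z : ℂ} (hz : 1 < z.re) :
    HasSum (fun n : ℕ => (z - 1) * ((n : ℂ) + 3 / 2) ^ (-z)) (halfZeta z) := by
  have h1 : z ≠ 1 := by rintro rfl; simp at hz
  convert! (hasSum_half_integer_cpow hz).mul_left (z - 1) using 1
  have := sub_ne_zero.mpr h1
  rw [halfZeta, riemannZeta_eq_inv_sub_mul h1]
  field_simp

lemma norm_half_integer_cpow (n : ℕ) (z : ℂ) :
    ‖((n : ℂ) + 3 / 2) ^ z‖ = ((n : ℝ) + 3 / 2) ^ z.re := by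
  have := Complex.norm_cpow_eq_rpow_re_of_pos (show (0 : ℝ) < n + 3 / 2 by positivity) z
  push_cast at this
  exact this

lemma summable_half_integer_rpow {x : ℝ} (hx : 1 < x) :
    Summable fun n : ℕ => ((n : ℝ) + 3 / 2) ^ (-x) := by
  refine ((Real.summable_one_div_nat_add_rpow (3 / 2) x).mpr hx).congr fun n => ?_
  rw [abs_of_nonneg (by positivity), Real.rpow_neg (by positivity), one_div]

lemma norm_halfZeta_le {z : ℂ} (hz : 2 ≤ z.re) :
    ‖halfZeta z‖ ≤ ‖z - 1‖ * ((3 / 2 : ℝ) ^ (2 - z.re) *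
      ∑' n : ℕ, ((n : ℝ) + 3 / 2) ^ (-2 : ℝ)) := by
  rw [← (hasSum_halfZeta (by linarith)).tsum_eq, tsum_mul_left, norm_mul]
  gcongr
  rw [← tsum_mul_left]
  refine tsum_of_norm_bounded
    ((summable_half_integer_rpow one_lt_two).mul_left _).hasSum fun n => ?_
  rw [norm_half_integer_cpow, Complex.neg_re,
    show -z.re = (2 - z.re) + (-2) by ring, Real.rpow_add (by positivity)]
  gcongr ?_ * _
  exact Real.rpow_le_rpow_of_nonpos (by norm_num) (by linarith [Nat.cast_nonneg (α := ℝ) n])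
    (by linarith)

/-- The coefficient of `x ^ k` in the expansion of `(1 - x) ^ (-s)`. -/
noncomputable def risingCoeff (k : ℕ) (s : ℂ) : ℂ :=
  (ascPochhammer ℂ k).eval s / k.factorial

lemma risingCoeff_zero (s : ℂ) : risingCoeff 0 s = 1 := by simp [risingCoeff]

lemma risingCoeff_succ (k : ℕ) (s : ℂ) :
    risingCoeff (k + 1) s = risingCoeff k s * (s + k) / (k + 1) := by
  rw [risingCoeff, risingCoeff, ascPochhammer_succ_eval, Nat.factorial_succ]
  push_cast
  field_simp

lemma differentiable_risingCoeff (k : ℕ) : Differentiable ℂ (risingCoeff k) :=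
  (ascPochhammer ℂ k).differentiable.div_const _

lemma sub_one_mul_risingCoeff (k : ℕ) (s : ℂ) :
    (s - 1) * risingCoeff k s = risingCoeff k (s - 1) * (s - 1 + k) := by
  induction k with
  | zero => simp [risingCoeff_zero]
  | succ k ih =>
    rw [risingCoeff_succ, risingCoeff_succ, ← mul_div_assoc, ← mul_assoc, ih]
    push_cast
    ring

lemma norm_risingCoeff_le {M : ℕ} {s : ℂ} (hs : ‖s‖ ≤ M) (k : ℕ) :
    ‖risingCoeff k s‖ ≤ 2 ^ (M + k) := by
  suffices h : ‖risingCoeff k s‖ ≤ (M + k).choose k from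
    h.trans (by exact_mod_cast Nat.choose_le_two_pow _ _)
  induction k with
  | zero => simp [risingCoeff_zero]
  | succ k ih =>
    have h := Nat.add_one_mul_choose_eq (M + k) k
    have h' : ((M : ℝ) + k + 1) * (M + k).choose k = (M + (k + 1)).choose (k + 1) * (k + 1) := by
      exact_mod_cast h
    have hk : ‖((k : ℂ) + 1)‖ = k + 1 := by exact_mod_cast Complex.norm_natCast (k + 1)
    rw [risingCoeff_succ, norm_div, norm_mul, hk, div_le_iff₀ (by positivity), ← h',
      mul_comm]
    gcongr
    calc ‖s + k‖ ≤ ‖s‖ + ‖(k : ℂ)‖ := norm_add_le _ _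
      _ ≤ M + k + 1 := by rw [Complex.norm_natCast]; linarith

lemma hasSum_risingCoeff {x : ℂ} (hx : ‖x‖ < 1) (s : ℂ) :
    HasSum (fun k => risingCoeff k s * x ^ k) (1 / (1 - x) ^ s) := by
  have h := (Complex.one_div_one_sub_cpow_hasFPowerSeriesOnBall_zero s).hasSum
    (y := x) (by rw [Metric.mem_eball, edist_zero_right]; rwa [← ofReal_norm, ENNReal.ofReal_lt_one])
  convert! h using 1
  · ext k
    rw [FormalMultilinearSeries.ofScalars_apply_eq, smul_eq_mul, ← Ring.multichoose_eq]
    congr 1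
    have := Ring.factorial_nsmul_multichoose_eq_ascPochhammer s k
    rw [Polynomial.ascPochhammer_smeval_eq_eval, nsmul_eq_mul] at this
    rw [risingCoeff, ← this, mul_div_cancel_left₀]
    exact_mod_cast k.factorial_ne_zero
  · simp

lemma summand_hasSum (s : ℂ) (n : ℕ) :
    HasSum (fun k : ℕ => 2 * risingCoeff k s * (1 / 4) ^ k *
        ((n : ℂ) + 3 / 2) ^ (-(2 * s + 2 * k - 1)))
      ((2 * ((n : ℂ) + 1) + 1) * (((n : ℂ) + 1) * ((n : ℂ) + 2)) ^ (-s)) := by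
  set w : ℝ := n + 3 / 2 with hw
  have hwc : (n : ℂ) + 3 / 2 = w := by simp [hw]
  have hw0 : 0 < w := by positivity
  have hw1 : 1 ≤ w := by linarith [Nat.cast_nonneg (α := ℝ) n]
  have hwne : (w : ℂ) ≠ 0 := by exact_mod_cast hw0.ne'
  set x : ℝ := 1 / (4 * w ^ 2) with hx
  have hx0 : 0 ≤ x := by positivity
  have hx1 : x < 1 := by rw [hx, div_lt_one (by positivity)]; nlinarith
  have h := (hasSum_risingCoeff (x := x) (by simpa [abs_of_nonneg hx0] using hx1) s).mul_left
    (2 * (w : ℂ) ^ (1 - 2 * s))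
  convert! h using 1
  · ext k
    rw [hwc, show -(2 * s + 2 * k - 1) = (1 - 2 * s) - ((2 * k : ℕ) : ℂ) by push_cast; ring,
      Complex.cpow_sub _ _ hwne, Complex.cpow_natCast, hx]
    push_cast
    rw [div_pow, div_pow, mul_pow, pow_mul, one_pow]
    field_simp
  · have e1 : ((n : ℂ) + 1) * ((n : ℂ) + 2) = ((w * w : ℝ) : ℂ) * ((1 - x : ℝ) : ℂ) := by
      rw [← Complex.ofReal_mul, hx, show w * w * (1 - 1 / (4 * w ^ 2)) = w * w - 1 / 4 by
        field_simp, hw]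
      push_cast
      ring
    rw [e1, Complex.mul_cpow_ofReal_nonneg (by positivity) (by linarith), Complex.ofReal_mul,
      Complex.mul_cpow_ofReal_nonneg hw0.le hw0.le, Complex.cpow_neg ((1 - x : ℝ) : ℂ),
      show (2 * ((n : ℂ) + 1) + 1) = 2 * w by rw [← hwc]; ring,
      show 1 - 2 * s = 1 + (-s + -s) by ring, Complex.cpow_add _ _ hwne,
      Complex.cpow_add _ _ hwne, Complex.cpow_one]
    push_cast
    ring

lemma summable_double {s : ℂ} (hs : 1 < s.re) :
    Summable (Function.uncurry fun n k : ℕ => 2 * risingCoeff k s * (1 / 4) ^ k *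
        ((n : ℂ) + 3 / 2) ^ (-(2 * s + 2 * k - 1))) := by
  obtain ⟨M, hM⟩ := exists_nat_ge ‖s‖
  have h1 := summable_half_integer_rpow (x := 2 * s.re - 1) (by linarith)
  have h2 : Summable fun k : ℕ => 2 ^ (M + 1) * (2 / 9 : ℝ) ^ k :=
    (summable_geometric_of_lt_one (by norm_num) (by norm_num)).mul_left _
  refine Summable.of_norm_bounded (h1.mul_of_nonneg h2 (fun n => by positivity)
    fun k => by positivity) ?_
  rintro ⟨n, k⟩
  have hb : ((n : ℝ) + 3 / 2) ^ (-(2 * s.re + 2 * k - 1))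
      ≤ ((n : ℝ) + 3 / 2) ^ (-(2 * s.re - 1)) * (4 / 9) ^ k := by
    rw [show -(2 * s.re + 2 * k - 1) = -(2 * s.re - 1) + (-2) * (k : ℕ) by ring,
      Real.rpow_add (by positivity), Real.rpow_mul_natCast (by positivity)]
    gcongr
    calc ((n : ℝ) + 3 / 2) ^ (-2 : ℝ) ≤ (3 / 2 : ℝ) ^ (-2 : ℝ) :=
          Real.rpow_le_rpow_of_nonpos (by norm_num) (by linarith [Nat.cast_nonneg (α := ℝ) n])
            (by norm_num)
      _ = 4 / 9 := by rw [Real.rpow_neg (by norm_num)]; norm_num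
  simp only [Function.uncurry_apply_pair, norm_mul, norm_half_integer_cpow, norm_pow]
  have e : (-(2 * s + 2 * (k : ℂ) - 1)).re = -(2 * s.re + 2 * k - 1) := by simp
  rw [e]
  calc ‖(2 : ℂ)‖ * ‖risingCoeff k s‖ * ‖(1 / 4 : ℂ)‖ ^ k *
        ((n : ℝ) + 3 / 2) ^ (-(2 * s.re + 2 * k - 1))
      ≤ 2 * 2 ^ (M + k) * (1 / 4) ^ k *
        (((n : ℝ) + 3 / 2) ^ (-(2 * s.re - 1)) * (4 / 9) ^ k) := by
        gcongr
        · simp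
        · exact norm_risingCoeff_le hM k
        · simp
    _ = ((n : ℝ) + 3 / 2) ^ (-(2 * s.re - 1)) * (2 ^ (M + 1) * (2 * (1 / 4) * (4 / 9)) ^ k) := by
        rw [mul_pow, mul_pow]; ring
    _ = _ := by norm_num

/-- The terms of a series of entire functions extending `(s - 1) * Z(s)`. -/
noncomputable def contTerm (k : ℕ) (s : ℂ) : ℂ :=
  risingCoeff k (s - 1) * (1 / 4) ^ k * halfZeta (2 * s + 2 * k - 1)

lemma differentiable_contTerm (k : ℕ) : Differentiable ℂ (contTerm k) := by
  unfold contTerm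
  have h1 := (differentiable_risingCoeff k).comp (differentiable_id.sub_const (1 : ℂ))
  have h2 := differentiable_halfZeta.comp
    (((differentiable_id.const_mul (2 : ℂ)).add_const (2 * (k : ℂ))).sub_const 1)
  exact (h1.mul_const _).mul h2

lemma norm_contTerm_add_le {M : ℕ} {s : ℂ} (hs : ‖s‖ ≤ M) (k : ℕ) :
    ‖contTerm (k + (M + 2)) s‖ ≤ 2 ^ (4 * M + 8) *
      (∑' n : ℕ, ((n : ℝ) + 3 / 2) ^ (-2 : ℝ)) * (4 / 9) ^ k := by
  set K := k + (M + 2) with hK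
  set B := ∑' n : ℕ, ((n : ℝ) + 3 / 2) ^ (-2 : ℝ)
  have hB : 0 ≤ B := tsum_nonneg fun n => by positivity
  have hKr : (K : ℝ) = k + (M + 2) := by simp [hK]
  have hre : -(M : ℝ) ≤ s.re := by
    have := (abs_le.mp (Complex.abs_re_le_norm s)).1
    linarith
  have e : (2 * s + 2 * (K : ℂ) - 1).re = 2 * s.re + 2 * K - 1 := by simp
  have h1 : ‖risingCoeff K (s - 1)‖ ≤ 2 ^ (M + 1 + K) := by
    refine norm_risingCoeff_le ?_ K
    calc ‖s - 1‖ ≤ ‖s‖ + ‖(1 : ℂ)‖ := norm_sub_le _ _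
      _ ≤ ((M + 1 : ℕ) : ℝ) := by rw [norm_one]; push_cast; linarith
  have h2 := norm_halfZeta_le (z := 2 * s + 2 * (K : ℂ) - 1)
    (by rw [e, hKr]; linarith [Nat.cast_nonneg (α := ℝ) k])
  rw [e] at h2
  have h3 : (3 / 2 : ℝ) ^ (2 - (2 * s.re + 2 * K - 1)) ≤ (4 / 9) ^ k := by
    calc (3 / 2 : ℝ) ^ (2 - (2 * s.re + 2 * K - 1)) ≤ (3 / 2 : ℝ) ^ ((-2 : ℝ) * (k : ℕ)) := by
          apply Real.rpow_le_rpow_of_exponent_le (by norm_num)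
          rw [hKr]; linarith
      _ = (4 / 9) ^ k := by
          rw [Real.rpow_mul_natCast (by norm_num), Real.rpow_neg (by norm_num)]; norm_num
  have h4 : ‖2 * s + 2 * (K : ℂ) - 1 - 1‖ ≤ 2 ^ (M + 1 + K) := by
    have hlt : ((M + K + 1 : ℕ) : ℝ) ≤ 2 ^ (M + K) := by
      exact_mod_cast Nat.lt_two_pow_self (n := M + K)
    push_cast at hlt
    calc ‖2 * s + 2 * (K : ℂ) - 1 - 1‖ = ‖2 * s + 2 * (K : ℂ) - 2‖ := by congr 1; ring
      _ ≤ ‖2 * s‖ + ‖2 * (K : ℂ)‖ + ‖(2 : ℂ)‖ :=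
          (norm_sub_le _ _).trans (by gcongr; exact norm_add_le _ _)
      _ ≤ 2 * (M + K + 1) := by simp; linarith
      _ ≤ 2 * 2 ^ (M + K) := by gcongr
      _ = 2 ^ (M + 1 + K) := by ring
  calc ‖contTerm K s‖ = ‖risingCoeff K (s - 1)‖ * (1 / 4) ^ K *
        ‖halfZeta (2 * s + 2 * (K : ℂ) - 1)‖ := by
        rw [contTerm, norm_mul, norm_mul, norm_pow]; simp
    _ ≤ 2 ^ (M + 1 + K) * (1 / 4) ^ K * (2 ^ (M + 1 + K) * ((4 / 9) ^ k * B)) := by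
        gcongr
        exact h2.trans (by gcongr)
    _ = 2 ^ (2 * M + 2) * (2 * (1 / 4) * 2) ^ K * B * (4 / 9) ^ k := by
        rw [mul_pow, mul_pow]; ring
    _ = 2 ^ (2 * M + 2) * B * (4 / 9) ^ k := by norm_num
    _ ≤ _ := by gcongr <;> norm_num

lemma summable_contTerm (s : ℂ) : Summable fun k => contTerm k s := by
  obtain ⟨M, hM⟩ := exists_nat_ge ‖s‖
  rw [← summable_nat_add_iff (M + 2)]
  exact .of_norm_bounded ((summable_geometric_of_lt_one (by norm_num) (by norm_num)).mul_left _)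
    (norm_contTerm_add_le hM)

lemma differentiable_tsum_contTerm : Differentiable ℂ fun s => ∑' k, contTerm k s := by
  intro s
  obtain ⟨M, hM⟩ := exists_nat_gt ‖s‖
  have hmem : s ∈ Metric.ball (0 : ℂ) M := by simpa using hM
  have htail : DifferentiableOn ℂ (fun s => ∑' k, contTerm (k + (M + 2)) s)
      (Metric.ball (0 : ℂ) M) :=
    Complex.differentiableOn_tsum_of_summable_norm
      ((summable_geometric_of_lt_one (by norm_num) (by norm_num)).mul_left _)
      (fun k => (differentiable_contTerm _).differentiableOn) Metric.isOpen_ball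
      fun k w hw => norm_contTerm_add_le (by simpa using (mem_ball_zero_iff.mp hw).le) k
  have e : (fun s => ∑' k, contTerm k s) = fun s =>
      ∑ k ∈ Finset.range (M + 2), contTerm k s + ∑' k, contTerm (k + (M + 2)) s := by
    ext t
    exact ((summable_contTerm t).sum_add_tsum_nat_add _).symm
  rw [e]
  refine DifferentiableAt.add ?_ (htail.differentiableAt (Metric.isOpen_ball.mem_nhds hmem))
  exact DifferentiableAt.fun_sum fun k _ => differentiable_contTerm k s

lemma tsum_contTerm_eq {s : ℂ} (hs : 1 < s.re) :
    ∑' k, contTerm k s = (s - 1) *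
      ∑' n : ℕ, (2 * ((n : ℂ) + 1) + 1) * (((n : ℂ) + 1) * ((n : ℂ) + 2)) ^ (-s) := by
  rw [tsum_congr fun n => (summand_hasSum s n).tsum_eq.symm, ← (summable_double hs).tsum_comm,
    ← tsum_mul_left]
  refine tsum_congr fun k => ?_
  have hk : 1 < (2 * s + 2 * (k : ℂ) - 1).re := by
    have : (2 * s + 2 * (k : ℂ) - 1).re = 2 * s.re + 2 * k - 1 := by simp
    rw [this]; linarith [Nat.cast_nonneg (α := ℝ) k]
  rw [contTerm, ← (hasSum_halfZeta hk).tsum_eq, tsum_mul_left, tsum_mul_left,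
    show (2 * s + 2 * (k : ℂ) - 1 - 1) = 2 * (s - 1 + k) by ring]
  linear_combination (-2 * (1 / 4) ^ k *
    ∑' n : ℕ, ((n : ℂ) + 3 / 2) ^ (-(2 * s + 2 * (k : ℂ) - 1))) * sub_one_mul_risingCoeff k s

lemma norm_le_pow_succ_of_deriv {F F' : ℝ → ℂ} {C : ℝ} {k : ℕ} (hC : 0 ≤ C) (h0 : F 0 = 0)
    (hF : ∀ t, 0 ≤ t → HasDerivAt F (F' t) t)
    (hb : ∀ t, 0 ≤ t → t ≤ 1 → ‖F' t‖ ≤ C * t ^ k) {t : ℝ} (ht : 0 ≤ t) (ht1 : t ≤ 1) :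
    ‖F t‖ ≤ C * t ^ (k + 1) := by
  have h := norm_image_sub_le_of_norm_deriv_le_segment' (f := F) (f' := F') (a := 0) (b := t)
    (C := C * t ^ k) (fun x hx => (hF x hx.1).hasDerivWithinAt)
    (fun x hx => (hb x hx.1 (hx.2.le.trans ht1)).trans
      (mul_le_mul_of_nonneg_left (pow_le_pow_left₀ hx.1 hx.2.le k) hC))
    t ⟨ht, le_rfl⟩
  rw [h0, sub_zero, sub_zero] at h
  rwa [pow_succ, ← mul_assoc]

lemma hasDerivAt_one_add_cpow (a : ℂ) {t : ℝ} (ht : 0 ≤ t) :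
    HasDerivAt (fun t : ℝ => (1 + (t : ℂ)) ^ a) (a * (1 + (t : ℂ)) ^ (a - 1)) t := by
  have h : HasDerivAt (fun z : ℂ => (1 + z) ^ a) (a * (1 + (t : ℂ)) ^ (a - 1) * 1) (t : ℂ) := by
    refine ((hasDerivAt_id (t : ℂ)).const_add 1).cpow_const ?_
    refine Or.inl ?_
    simp only [id, Complex.add_re, Complex.one_re, Complex.ofReal_re]
    linarith
  rw [mul_one] at h
  exact h.comp_ofReal

lemma norm_one_add_cpow_le {a : ℂ} {M : ℕ} (ha : ‖a‖ ≤ M) {t : ℝ} (ht : 0 ≤ t) (ht1 : t ≤ 1) :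
    ‖(1 + (t : ℂ)) ^ a‖ ≤ 2 ^ M := by
  have := Complex.norm_cpow_eq_rpow_re_of_pos (show 0 < 1 + t by linarith) a
  push_cast at this
  rw [this, ← Real.rpow_natCast]
  calc (1 + t) ^ a.re ≤ (1 + t) ^ (M : ℝ) :=
        Real.rpow_le_rpow_of_exponent_le (by linarith) ((Complex.re_le_norm a).trans ha)
    _ ≤ 2 ^ (M : ℝ) := by gcongr; linarith

lemma norm_sub_one_le {a : ℂ} {M : ℕ} (ha : ‖a‖ ≤ M) : ‖a - 1‖ ≤ (M + 1 : ℕ) := by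
  push_cast
  exact (norm_sub_le _ _).trans (by rw [norm_one]; linarith)

lemma norm_one_add_cpow_sub_one_le {a : ℂ} {M : ℕ} (ha : ‖a‖ ≤ M) {t : ℝ} (ht : 0 ≤ t)
    (ht1 : t ≤ 1) : ‖(1 + (t : ℂ)) ^ a - 1‖ ≤ M * 2 ^ (M + 1) * t := by
  have h := norm_le_pow_succ_of_deriv (F := fun t : ℝ => (1 + (t : ℂ)) ^ a - 1) (k := 0)
    (C := M * 2 ^ (M + 1)) (by positivity) (by simp)
    (fun t ht => (hasDerivAt_one_add_cpow a ht).sub_const 1)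
    (fun t ht ht1 => by
      rw [pow_zero, mul_one, norm_mul]
      gcongr
      exact norm_one_add_cpow_le (norm_sub_one_le ha) ht ht1) ht ht1
  simpa using h

lemma norm_one_add_cpow_sub_linear_le {a : ℂ} {M : ℕ} (ha : ‖a‖ ≤ M) {t : ℝ} (ht : 0 ≤ t)
    (ht1 : t ≤ 1) :
    ‖(1 + (t : ℂ)) ^ a - 1 - a * t‖ ≤ M * ((M + 1) * 2 ^ (M + 2)) * t ^ 2 := by
  refine norm_le_pow_succ_of_deriv (F := fun t : ℝ => (1 + (t : ℂ)) ^ a - 1 - a * t)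
    (F' := fun t : ℝ => a * ((1 + (t : ℂ)) ^ (a - 1) - 1)) (k := 1)
    (by positivity) (by simp) (fun t ht => ?_) (fun t ht ht1 => ?_) ht ht1
  · refine (((hasDerivAt_one_add_cpow a ht).sub_const 1).sub
      (((hasDerivAt_id (t : ℂ)).const_mul a).comp_ofReal)).congr_deriv ?_
    ring
  · rw [norm_mul, pow_one, mul_assoc]
    gcongr
    simpa using norm_one_add_cpow_sub_one_le (norm_sub_one_le ha) ht ht1

lemma norm_one_add_cpow_sub_quadratic_le {a : ℂ} {M : ℕ} (ha : ‖a‖ ≤ M) {t : ℝ} (ht : 0 ≤ t)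
    (ht1 : t ≤ 1) :
    ‖(1 + (t : ℂ)) ^ a - 1 - a * t - a * (a - 1) / 2 * t ^ 2‖
      ≤ M * ((M + 1) * ((M + 2) * 2 ^ (M + 3))) * t ^ 3 := by
  refine norm_le_pow_succ_of_deriv
    (F := fun t : ℝ => (1 + (t : ℂ)) ^ a - 1 - a * t - a * (a - 1) / 2 * t ^ 2)
    (F' := fun t : ℝ => a * ((1 + (t : ℂ)) ^ (a - 1) - 1 - (a - 1) * t)) (k := 2)
    (by positivity) (by simp) (fun t ht => ?_) (fun t ht ht1 => ?_) ht ht1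
  · refine ((((hasDerivAt_one_add_cpow a ht).sub_const 1).sub
      (((hasDerivAt_id (t : ℂ)).const_mul a).comp_ofReal)).sub
      ((((hasDerivAt_id (t : ℂ)).pow 2).const_mul (a * (a - 1) / 2)).comp_ofReal)).congr_deriv ?_
    simp
    ring
  · rw [norm_mul, mul_assoc]
    gcongr
    refine (norm_one_add_cpow_sub_linear_le (norm_sub_one_le ha) ht ht1).trans_eq ?_
    push_cast
    ring

/-- The summand of `Z` minus its leading asymptotics. -/
noncomputable def remTerm (n : ℕ) (s : ℂ) : ℂ :=
  (2 * ((n : ℂ) + 1) + 1) * (((n : ℂ) + 1) * ((n : ℂ) + 2)) ^ (-s)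
    - ((n : ℂ) + 1) ^ (1 - 2 * s) - ((n : ℂ) + 2) ^ (1 - 2 * s)
    - (1 - s) / 2 * (((n : ℂ) + 1) ^ (-(2 * s)) - ((n : ℂ) + 2) ^ (-(2 * s)))

lemma exists_norm_remTerm_le : ∃ C : ℝ, ∀ n : ℕ, ∀ s : ℂ, ‖s‖ ≤ 5 → -(1 / 4) ≤ s.re →
    ‖remTerm n s‖ ≤ C * ((n : ℝ) + 1) ^ (-(3 / 2 : ℝ)) := by
  obtain ⟨A, hA⟩ : ∃ A : ℝ, A = (11 : ℕ) * (((11 : ℕ) + 1) * (((11 : ℕ) + 2) * 2 ^ (11 + 3))) :=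
    ⟨_, rfl⟩
  obtain ⟨B, hB⟩ : ∃ B : ℝ, B = (11 : ℕ) * (((11 : ℕ) + 1) * 2 ^ (11 + 2)) := ⟨_, rfl⟩
  refine ⟨3 * A + A + 3 * B + 15, fun n s hs hre => ?_⟩
  set m : ℝ := (n : ℝ) + 1 with hm
  have hm0 : 0 < m := by positivity
  have hm1 : 1 ≤ m := by linarith [Nat.cast_nonneg (α := ℝ) n]
  have hmc : (n : ℂ) + 1 = m := by simp [hm]
  have hmne : (m : ℂ) ≠ 0 := by exact_mod_cast hm0.ne'
  set t : ℝ := m⁻¹ with ht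
  have ht0 : 0 ≤ t := by positivity
  have ht1 : t ≤ 1 := inv_le_one_of_one_le₀ hm1
  have hmt : (m : ℂ) * t = 1 := by rw [ht]; push_cast; field_simp
  have hn2 : (n : ℂ) + 2 = (m : ℂ) * ((1 + t : ℝ) : ℂ) := by
    push_cast
    linear_combination hmc - hmt
  have hcp (a : ℂ) : ((m : ℂ) * ((1 + t : ℝ) : ℂ)) ^ a = (m : ℂ) ^ a * (1 + (t : ℂ)) ^ a := by
    rw [Complex.mul_cpow_ofReal_nonneg hm0.le (by linarith)]
    push_cast
    rfl
  have hprod : (((n : ℂ) + 1) * ((n : ℂ) + 2)) ^ (-s) =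
      (m : ℂ) ^ (-s) * ((m : ℂ) ^ (-s) * (1 + (t : ℂ)) ^ (-s)) := by
    rw [hmc, hn2, ← Complex.ofReal_mul, Complex.mul_cpow_ofReal_nonneg hm0.le (by positivity),
      Complex.ofReal_mul, hcp]
  have hsq : (m : ℂ) ^ (-(2 * s)) = (m : ℂ) ^ (-s) * (m : ℂ) ^ (-s) := by
    rw [← Complex.cpow_add _ _ hmne]
    ring_nf
  have hpow : (m : ℂ) ^ (1 - 2 * s) = m * ((m : ℂ) ^ (-s) * (m : ℂ) ^ (-s)) := by
    rw [← hsq, sub_eq_add_neg, Complex.cpow_add _ _ hmne, Complex.cpow_one]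
  set eP := (1 + (t : ℂ)) ^ (-s) - 1 - (-s) * t - (-s) * (-s - 1) / 2 * t ^ 2 with heP
  set eQ := (1 + (t : ℂ)) ^ (1 - 2 * s) - 1 - (1 - 2 * s) * t
    - (1 - 2 * s) * (1 - 2 * s - 1) / 2 * t ^ 2 with heQ
  set eV := (1 + (t : ℂ)) ^ (-(2 * s)) - 1 - (-(2 * s)) * t with heV
  have hP : ‖eP‖ ≤ A * t ^ 3 := by
    rw [hA]
    exact norm_one_add_cpow_sub_quadratic_le (by rw [norm_neg]; push_cast; linarith) ht0 ht1
  have h2s : ‖2 * s‖ ≤ 10 := by rw [norm_mul, Complex.norm_ofNat]; linarith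
  have hQ : ‖eQ‖ ≤ A * t ^ 3 := by
    rw [hA]
    refine norm_one_add_cpow_sub_quadratic_le ((norm_sub_le _ _).trans ?_) ht0 ht1
    rw [norm_one]; push_cast; linarith
  have hV : ‖eV‖ ≤ B * t ^ 2 := by
    rw [hB]
    exact norm_one_add_cpow_sub_linear_le (by rw [norm_neg]; push_cast; linarith) ht0 ht1
  have hA0 : 0 ≤ A := by rw [hA]; positivity
  have hB0 : 0 ≤ B := by rw [hB]; positivity
  have key : remTerm n s = (m : ℂ) ^ (1 - 2 * s) *
      ((2 + t) * eP - eQ + (1 - s) / 2 * t * eV + s * (s + 1) / 2 * t ^ 3) := by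
    rw [remTerm, hprod, hmc, hn2, hcp, hcp, hpow, hsq, heP, heQ, heV]
    set X := (m : ℂ) ^ (-s)
    set P := (1 + (t : ℂ)) ^ (-s)
    set V := (1 + (t : ℂ)) ^ (-(2 * s))
    linear_combination (-X * X * P + (1 - s) / 2 * X * X * (1 - V)) * hmt
  have hφ : ‖(2 + t) * eP - eQ + (1 - s) / 2 * t * eV + s * (s + 1) / 2 * t ^ 3‖
      ≤ (3 * A + A + 3 * B + 15) * t ^ 3 := by
    have n1 : ‖(2 + t : ℂ)‖ ≤ 3 := by
      refine (norm_add_le _ _).trans ?_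
      rw [Complex.norm_ofNat, Complex.norm_real, Real.norm_of_nonneg ht0]
      linarith
    have n2 : ‖(1 - s) / 2‖ ≤ 3 := by
      rw [norm_div, Complex.norm_ofNat, div_le_iff₀ two_pos]
      refine (norm_sub_le _ _).trans ?_
      rw [norm_one]; linarith
    have n3 : ‖s * (s + 1) / 2‖ ≤ 15 := by
      rw [norm_div, Complex.norm_ofNat, div_le_iff₀ two_pos, norm_mul]
      have : ‖s + 1‖ ≤ 6 := (norm_add_le _ _).trans (by rw [norm_one]; linarith)
      calc ‖s‖ * ‖s + 1‖ ≤ 5 * 6 := by gcongr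
        _ = 15 * 2 := by norm_num
    have nt : ‖(t : ℂ)‖ = t := by rw [Complex.norm_real, Real.norm_of_nonneg ht0]
    calc ‖(2 + t) * eP - eQ + (1 - s) / 2 * t * eV + s * (s + 1) / 2 * t ^ 3‖
        ≤ ‖(2 + t : ℂ)‖ * ‖eP‖ + ‖eQ‖ + ‖(1 - s) / 2‖ * t * ‖eV‖ + ‖s * (s + 1) / 2‖ * t ^ 3 := by
          refine (norm_add_le _ _).trans (add_le_add ((norm_add_le _ _).trans
            (add_le_add ((norm_sub_le _ _).trans ?_) ?_)) ?_)
          · rw [norm_mul]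
          · rw [norm_mul, norm_mul, nt]
          · rw [norm_mul, norm_pow, nt]
      _ ≤ 3 * (A * t ^ 3) + A * t ^ 3 + 3 * t * (B * t ^ 2) + 15 * t ^ 3 := by gcongr
      _ = _ := by ring
  have hm2 : ‖(m : ℂ) ^ (1 - 2 * s)‖ * t ^ 3 ≤ m ^ (-(3 / 2 : ℝ)) := by
    have e : t ^ 3 = m ^ (-3 : ℝ) := by
      rw [ht, Real.rpow_neg hm0.le, inv_pow, ← Real.rpow_natCast]; norm_num
    rw [Complex.norm_cpow_eq_rpow_re_of_pos hm0, e, ← Real.rpow_add hm0]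
    refine Real.rpow_le_rpow_of_exponent_le hm1 ?_
    simp
    linarith
  rw [key, norm_mul]
  calc _ ≤ ‖(m : ℂ) ^ (1 - 2 * s)‖ * ((3 * A + A + 3 * B + 15) * t ^ 3) := by gcongr
    _ = (3 * A + A + 3 * B + 15) * (‖(m : ℂ) ^ (1 - 2 * s)‖ * t ^ 3) := by ring
    _ ≤ _ := by gcongr

lemma remTerm_zero (n : ℕ) : remTerm n 0 = 0 := by
  simp [remTerm]
  ring

lemma differentiable_remTerm (n : ℕ) : Differentiable ℂ (remTerm n) := by
  have h1 : (n : ℂ) + 1 ≠ 0 := by exact_mod_cast n.succ_ne_zero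
  have h2 : (n : ℂ) + 2 ≠ 0 := by exact_mod_cast (n + 1).succ_ne_zero
  have h12 := mul_ne_zero h1 h2
  have hc {b : ℂ} (hb : b ≠ 0) {g : ℂ → ℂ} (hg : Differentiable ℂ g) :
      Differentiable ℂ fun s => b ^ g s := fun s => (hg s).const_cpow (Or.inl hb)
  have e1 := hc h1 (g := fun s => 1 - 2 * s) (by fun_prop)
  have e2 := hc h2 (g := fun s => 1 - 2 * s) (by fun_prop)
  have e3 := hc h1 (g := fun s => -(2 * s)) (by fun_prop)
  have e4 := hc h2 (g := fun s => -(2 * s)) (by fun_prop)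
  have e5 := hc h12 (g := fun s => -s) (by fun_prop)
  unfold remTerm
  fun_prop

lemma deriv_remTerm_zero (n : ℕ) : deriv (remTerm n) 0 = 0 := by
  have h1 : (n : ℂ) + 1 ≠ 0 := by exact_mod_cast n.succ_ne_zero
  have h2 : (n : ℂ) + 2 ≠ 0 := by exact_mod_cast (n + 1).succ_ne_zero
  have hlog : Complex.log (((n : ℂ) + 1) * ((n : ℂ) + 2)) =
      Complex.log ((n : ℂ) + 1) + Complex.log ((n : ℂ) + 2) := by
    have := Complex.log_ofReal_mul (r := (n : ℝ) + 1) (by positivity) h2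
    push_cast at this
    rw [this, Complex.ofReal_log (by positivity)]
    push_cast
    rfl
  have hd1 : HasDerivAt (fun s : ℂ => 1 - 2 * s) (-2) 0 := by
    simpa using ((hasDerivAt_id (0 : ℂ)).const_mul 2).const_sub 1
  have hd2 : HasDerivAt (fun s : ℂ => -(2 * s)) (-2) 0 := by
    simpa using ((hasDerivAt_id (0 : ℂ)).const_mul 2).fun_neg
  have hd3 : HasDerivAt (fun s : ℂ => (1 - s) / 2) (-1 / 2) 0 := by
    simpa using ((hasDerivAt_id (0 : ℂ)).const_sub 1).div_const 2
  have H := (((((hasDerivAt_neg (0 : ℂ)).const_cpow (Or.inl (mul_ne_zero h1 h2))).const_mul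
      (2 * ((n : ℂ) + 1) + 1)).sub (hd1.const_cpow (Or.inl h1))).sub
      (hd1.const_cpow (Or.inl h2))).sub
      (hd3.mul ((hd2.const_cpow (Or.inl h1)).sub (hd2.const_cpow (Or.inl h2))))
  refine (HasDerivAt.deriv (f := remTerm n) H).trans ?_
  simp [hlog]
  ring

lemma summable_add_one_rpow : Summable fun n : ℕ => ((n : ℝ) + 1) ^ (-(3 / 2 : ℝ)) := by
  refine ((Real.summable_one_div_nat_add_rpow 1 (3 / 2)).mpr (by norm_num)).congr fun n => ?_
  rw [abs_of_nonneg (by positivity), Real.rpow_neg (by positivity), one_div]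

lemma norm_le_and_re_of_mem_ball {s : ℂ} (hs : s ∈ Metric.ball (2 : ℂ) (9 / 4)) :
    ‖s‖ ≤ 5 ∧ -(1 / 4) ≤ s.re := by
  rw [mem_ball_iff_norm] at hs
  constructor
  · calc ‖s‖ = ‖(s - 2) + 2‖ := by rw [sub_add_cancel]
      _ ≤ ‖s - 2‖ + ‖(2 : ℂ)‖ := norm_add_le _ _
      _ ≤ 5 := by rw [Complex.norm_ofNat]; linarith
  · have h := (abs_le.mp (Complex.abs_re_le_norm (s - 2))).1
    simp at h
    linarith

lemma differentiableOn_tsum_remTerm :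
    DifferentiableOn ℂ (fun s => ∑' n, remTerm n s) (Metric.ball 2 (9 / 4)) := by
  obtain ⟨C, hC⟩ := exists_norm_remTerm_le
  exact Complex.differentiableOn_tsum_of_summable_norm (summable_add_one_rpow.mul_left C)
    (fun n => (differentiable_remTerm n).differentiableOn) Metric.isOpen_ball fun n s hs =>
      hC n s (norm_le_and_re_of_mem_ball hs).1 (norm_le_and_re_of_mem_ball hs).2

lemma zero_mem_ball_two : (0 : ℂ) ∈ Metric.ball (2 : ℂ) (9 / 4) := by
  rw [mem_ball_iff_norm, zero_sub, norm_neg, Complex.norm_ofNat]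
  norm_num

lemma deriv_tsum_remTerm_zero : deriv (fun s => ∑' n, remTerm n s) 0 = 0 := by
  obtain ⟨C, hC⟩ := exists_norm_remTerm_le
  have h := Complex.hasSum_deriv_of_summable_norm (summable_add_one_rpow.mul_left C)
    (fun n => (differentiable_remTerm n).differentiableOn) Metric.isOpen_ball (fun n s hs =>
      hC n s (norm_le_and_re_of_mem_ball hs).1 (norm_le_and_re_of_mem_ball hs).2)
    zero_mem_ball_two
  rw [← h.tsum_eq]
  simp [deriv_remTerm_zero]

lemma summable_sphereZeta {s : ℂ} (hs : 1 < s.re) :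
    Summable fun n : ℕ =>
      (2 * ((n : ℂ) + 1) + 1) * (((n : ℂ) + 1) * ((n : ℂ) + 2)) ^ (-s) :=
  (summable_double hs).prod.congr fun n => (summand_hasSum s n).tsum_eq

lemma hasSum_add_one_cpow {z : ℂ} (hz : 1 < z.re) :
    HasSum (fun n : ℕ => ((n : ℂ) + 1) ^ (-z)) (riemannZeta z) := by
  have h := (summable_nat_add_iff 1).mpr (Complex.summable_one_div_nat_cpow.mpr hz)
  push_cast at h
  rw [zeta_eq_tsum_one_div_nat_add_one_cpow hz]
  convert! h.hasSum using 2 with n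
  rw [Complex.cpow_neg, one_div]

lemma hasSum_add_two_cpow {z : ℂ} (hz : 1 < z.re) :
    HasSum (fun n : ℕ => ((n : ℂ) + 2) ^ (-z)) (riemannZeta z - 1) := by
  have h := (hasSum_nat_add_iff' 1).mpr (hasSum_add_one_cpow hz)
  convert! h using 1
  · ext n
    push_cast
    congr 1
    ring
  · simp

lemma tsum_remTerm_eq {s : ℂ} (hs : 1 < s.re) :
    ∑' n, remTerm n s =
      ∑' n : ℕ, (2 * ((n : ℂ) + 1) + 1) * (((n : ℂ) + 1) * ((n : ℂ) + 2)) ^ (-s)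
        - (2 * riemannZeta (2 * s - 1) - 1 + (1 - s) / 2) := by
  have h1 : 1 < (2 * s - 1).re := by simp; linarith
  have h2 : 1 < (2 * s).re := by simp; linarith
  have h := (((summable_sphereZeta hs).hasSum.sub (hasSum_add_one_cpow h1)).sub
    (hasSum_add_two_cpow h1)).sub
    (((hasSum_add_one_cpow h2).sub (hasSum_add_two_cpow h2)).mul_left ((1 - s) / 2))
  simp only [neg_sub] at h
  refine (HasSum.tsum_eq (f := fun n => remTerm n s) h).trans ?_
  ring

/-- An explicit continuation of the spectral zeta function of the sphere to a neighbourhood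
of `0`. -/
noncomputable def sphereZetaNearZero (s : ℂ) : ℂ :=
  2 * riemannZeta (2 * s - 1) - 1 + (1 - s) / 2 + ∑' n, remTerm n s

lemma tsum_contTerm_eq_on_ball {s : ℂ} (hs : s ∈ Metric.ball (2 : ℂ) (9 / 4)) (h1 : s ≠ 1) :
    ∑' k, contTerm k s = (s - 1) * sphereZetaNearZero s := by
  set Q : ℂ → ℂ := fun s =>
    riemannZeta₁ (2 * s - 1) + (s - 1) * (-1 + (1 - s) / 2 + ∑' n, remTerm n s) with hQ
  have hQeq {s : ℂ} (h1 : s ≠ 1) : Q s = (s - 1) * sphereZetaNearZero s := by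
    have hne := sub_ne_zero.mpr h1
    have hz : 2 * s - 1 ≠ 1 := fun h => h1 (by linear_combination h / 2)
    rw [hQ, sphereZetaNearZero, riemannZeta_eq_inv_sub_mul hz,
      show 2 * s - 1 - 1 = 2 * (s - 1) by ring]
    field_simp
    ring
  have hQd : DifferentiableOn ℂ Q (Metric.ball 2 (9 / 4)) := by
    have h1 : Differentiable ℂ fun s : ℂ => riemannZeta₁ (2 * s - 1) := by fun_prop
    have h2 : Differentiable ℂ fun s : ℂ => s - 1 := by fun_prop
    have h3 : Differentiable ℂ fun s : ℂ => -1 + (1 - s) / 2 := by fun_prop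
    exact h1.differentiableOn.add
      (h2.differentiableOn.mul (h3.differentiableOn.add differentiableOn_tsum_remTerm))
  have hev : (fun s => ∑' k, contTerm k s) =ᶠ[nhds 2] Q := by
    have hopen : IsOpen {s : ℂ | 1 < s.re} := isOpen_lt continuous_const Complex.continuous_re
    filter_upwards [hopen.mem_nhds (show (2 : ℂ) ∈ {s : ℂ | 1 < s.re} by simp)] with s hs
    have hs1 : s ≠ 1 := by rintro rfl; simp at hs
    rw [hQeq hs1, tsum_contTerm_eq hs, sphereZetaNearZero, tsum_remTerm_eq hs]
    ring
  rw [← hQeq h1]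
  exact (differentiable_tsum_contTerm.differentiableOn.analyticOnNhd
    Metric.isOpen_ball).eqOn_of_preconnected_of_eventuallyEq
    (hQd.analyticOnNhd Metric.isOpen_ball) (convex_ball _ _).isPreconnected
    (Metric.mem_ball_self (by norm_num)) hev hs

lemma riemannZeta_neg_one : riemannZeta (-1) = -1 / 12 := by
  have h := riemannZeta_neg_nat_eq_bernoulli 1
  norm_num [bernoulli_two] at h
  exact h.trans (by norm_num)

lemma sphereZetaNearZero_zero : sphereZetaNearZero 0 = -(2 / 3) := by
  simp [sphereZetaNearZero, remTerm_zero, riemannZeta_neg_one]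
  norm_num

lemma deriv_sphereZetaNearZero_zero :
    deriv sphereZetaNearZero 0 = 4 * deriv riemannZeta (-1) - 1 / 2 := by
  have hT := (differentiableOn_tsum_remTerm.differentiableAt
    (Metric.isOpen_ball.mem_nhds zero_mem_ball_two)).hasDerivAt
  rw [deriv_tsum_remTerm_zero] at hT
  have hlin : HasDerivAt (fun s : ℂ => 2 * s - 1) 2 0 := by
    simpa using ((hasDerivAt_id (0 : ℂ)).const_mul 2).sub_const 1
  have hd3 : HasDerivAt (fun s : ℂ => (1 - s) / 2) (-1 / 2) 0 := by
    simpa using ((hasDerivAt_id (0 : ℂ)).const_sub 1).div_const 2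
  have hz : HasDerivAt riemannZeta (deriv riemannZeta (-1)) (2 * 0 - 1) := by
    rw [mul_zero, zero_sub]
    exact (differentiableAt_riemannZeta (by norm_num)).hasDerivAt
  have H := ((((hz.comp (0 : ℂ) hlin).const_mul 2).sub_const 1).add hd3).add hT
  refine (HasDerivAt.deriv (f := sphereZetaNearZero) H).trans ?_
  ring

/-- the spectral zeta function of the round 2-sphere,
`Z(s) = ∑_{n≥1} (2n+1)·(n(n+1))^{-s}`, converges absolutely for `Re s > 2`, and every
analytic continuation `f` of the series to `0` satisfies `f(0) = −2/3` and
`f′(0) = 4·ζ′(−1) − 1/2`. -/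
theorem stmt15 :
    (∀ s : ℂ, 2 < s.re →
      Summable (fun n : ℕ =>
        ‖(2 * ((n : ℂ) + 1) + 1) * (((n : ℂ) + 1) * ((n : ℂ) + 2)) ^ (-s)‖)) ∧
    ∀ f : ℂ → ℂ,
      IsContinuationAt
        (fun s => ∑' n : ℕ, (2 * ((n : ℂ) + 1) + 1) * (((n : ℂ) + 1) * ((n : ℂ) + 2)) ^ (-s))
        2 0 f →
      f 0 = -(2 / 3) ∧ deriv f 0 = 4 * deriv riemannZeta (-1) - 1 / 2 := by
  refine ⟨fun s hs => (summable_sphereZeta (by linarith)).norm, ?_⟩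
  rintro f ⟨U, hUo, hUc, h0, hU, hf, hfeq⟩
  have hmul : Set.EqOn (fun s => (s - 1) * f s) (fun s => ∑' k, contTerm k s) U := by
    have hev : (fun s => (s - 1) * f s) =ᶠ[nhds 3] fun s => ∑' k, contTerm k s := by
      have hopen : IsOpen {s : ℂ | 2 < s.re} := isOpen_lt continuous_const Complex.continuous_re
      filter_upwards [hopen.mem_nhds (show (3 : ℂ) ∈ {s : ℂ | 2 < s.re} by norm_num)] with s hs
      rw [hfeq s hs, tsum_contTerm_eq (one_lt_two.trans hs)]
    refine AnalyticOnNhd.eqOn_of_preconnected_of_eventuallyEq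
      (fun s hs => (analyticAt_id.sub analyticAt_const).mul (hf s hs))
      (fun s _ => differentiable_tsum_contTerm.analyticAt s) hUc.isPreconnected
      (hU (show (2 : ℝ) < (3 : ℂ).re by norm_num)) hev
  have hne : ∀ᶠ s : ℂ in nhds 0, s ≠ 1 := isOpen_ne.mem_nhds zero_ne_one
  have hfU : f =ᶠ[nhds 0] sphereZetaNearZero := by
    filter_upwards [hne, Metric.isOpen_ball.mem_nhds zero_mem_ball_two, hUo.mem_nhds h0] with s h1 hs hsU
    exact mul_left_cancel₀ (sub_ne_zero.mpr h1)
      ((hmul hsU).trans (tsum_contTerm_eq_on_ball hs h1))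
  exact ⟨hfU.eq_of_nhds.trans sphereZetaNearZero_zero,
    hfU.deriv_eq.trans deriv_sphereZetaNearZero_zero⟩
end

section
/- Let α ≥ 0 and β > 0 be real numbers, let x > −1 be real, and let p be real with (n+x)^β + p > 0 for every integer n ≥ 1. The series z(s) = ∑_{n=1}^∞ (n+x)^α·((n+x)^β + p)^{-s} converges absolutely for Re(s) > (1+α)/β. If (1+α)/β is not a positive integer, then every analytic continuation f of this series to the point 0 satisfies f(0) = ζ_H(−α, x+1). If (1+α)/β = k is a positive integer, then every analytic continuation f of this series to the point 0 satisfies f(0) = ζ_H(−α, x+1) + ((−1)^k / (α+1))·p^k. -/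
/-- The simple zeta function `z(s; α, β, x, p) = ∑_{n≥1} (n+x)^α ((n+x)^β + p)^{-s}`. -/
noncomputable def zSimple (α β x p : ℝ) : ℂ → ℂ := fun s =>
  ∑' n : ℕ, ((((n : ℝ) + 1 + x) ^ α : ℝ) : ℂ) *
    ((((n : ℝ) + 1 + x) ^ β + p : ℝ) : ℂ) ^ (-s)

open Complex Filter Topology

/-- The generalized binomial coefficient `a (a - 1) ⋯ (a - j + 1) / j!`. -/
noncomputable def binomCoeff (a : ℂ) (j : ℕ) : ℂ :=
  (∏ i ∈ Finset.range j, (a - i)) / (j.factorial : ℂ)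

lemma binomCoeff_zero_right (a : ℂ) : binomCoeff a 0 = 1 := by simp [binomCoeff]

lemma binomCoeff_succ_mul (a : ℂ) (j : ℕ) :
    binomCoeff a (j + 1) * (j + 1) = a * binomCoeff (a - 1) j := by
  have h1 : ((j : ℂ) + 1) ≠ 0 := by exact_mod_cast j.succ_ne_zero
  have h2 : (j.factorial : ℂ) ≠ 0 := by exact_mod_cast j.factorial_ne_zero
  unfold binomCoeff
  rw [Finset.prod_range_succ', Nat.factorial_succ]
  push_cast
  have : ∀ i : ℕ, a - ((i : ℂ) + 1) = a - 1 - i := fun i => by ring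
  simp only [this]
  field_simp
  ring

lemma differentiable_binomCoeff_neg (j : ℕ) :
    Differentiable ℂ fun s : ℂ => binomCoeff (-s) j := by
  unfold binomCoeff
  fun_prop

lemma binomCoeff_zero_left {j : ℕ} (hj : 0 < j) : binomCoeff 0 j = 0 := by
  unfold binomCoeff
  rw [Finset.prod_eq_zero (Finset.mem_range.2 hj) (by simp), zero_div]

/-- The remainder of the binomial series of `(1 + t) ^ a`. -/
noncomputable def powRemainder (J : ℕ) (a t : ℂ) : ℂ :=
  (1 + t) ^ a - ∑ j ∈ Finset.range J, binomCoeff a j * t ^ j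

lemma hasDerivAt_powRemainder_succ (J : ℕ) (a : ℂ) {t : ℂ} (ht : 1 + t ∈ slitPlane) :
    HasDerivAt (powRemainder (J + 1) a) (a * powRemainder J (a - 1) t) t := by
  have h1 : HasDerivAt (fun t : ℂ => (1 + t) ^ a) (a * (1 + t) ^ (a - 1) * 1) t :=
    ((hasDerivAt_id t).const_add 1).cpow_const ht
  have h2 : HasDerivAt (fun t : ℂ => ∑ j ∈ Finset.range (J + 1), binomCoeff a j * t ^ j)
      (∑ j ∈ Finset.range (J + 1), binomCoeff a j * ((j : ℂ) * t ^ (j - 1))) t :=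
    HasDerivAt.fun_sum fun j _ => (hasDerivAt_pow j t).const_mul _
  refine (h1.sub h2).congr_deriv ?_
  rw [Finset.sum_range_succ', powRemainder, mul_sub, Finset.mul_sum]
  simp only [Nat.cast_zero, zero_mul, mul_zero, add_zero, mul_one, Nat.add_sub_cancel]
  congr 1
  refine Finset.sum_congr rfl fun j _ => ?_
  rw [← mul_assoc, ← mul_assoc, ← binomCoeff_succ_mul]
  push_cast
  ring

lemma powRemainder_succ_zero (J : ℕ) (a : ℂ) : powRemainder (J + 1) a 0 = 0 := by
  simp [powRemainder, Finset.sum_range_succ', binomCoeff_zero_right]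

lemma norm_powRemainder_le {A B : ℝ} (hA : -1 < A) (hA0 : A ≤ 0) (hB : 0 ≤ B) (J : ℕ) :
    ∀ R : ℝ, 0 ≤ R → ∃ C : ℝ, 0 ≤ C ∧ ∀ a : ℂ, ‖a‖ ≤ R → ∀ t ∈ Set.Icc A B,
      ‖powRemainder J a (t : ℂ)‖ ≤ C * |t| ^ J := by
  induction J with
  | zero =>
    intro R hR
    refine ⟨Real.exp ((|Real.log (1 + A)| + |Real.log (1 + B)|) * R), (Real.exp_pos _).le,
      fun a ha t ht => ?_⟩
    have h1 : 0 < 1 + t := by linarith [ht.1]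
    have h2 : ((1 : ℂ) + t) = ((1 + t : ℝ) : ℂ) := by push_cast; rfl
    simp only [powRemainder, Finset.range_zero, Finset.sum_empty, sub_zero, pow_zero, mul_one]
    rw [h2, norm_cpow_eq_rpow_re_of_pos h1, Real.rpow_def_of_pos h1]
    refine Real.exp_le_exp.2 ((le_abs_self _).trans ?_)
    rw [abs_mul]
    refine mul_le_mul ?_ ((abs_re_le_norm a).trans ha) (abs_nonneg _) (by positivity)
    have h3 : Real.log (1 + A) ≤ Real.log (1 + t) :=
      Real.log_le_log (by linarith) (by linarith [ht.1])
    have h4 : Real.log (1 + t) ≤ Real.log (1 + B) := Real.log_le_log h1 (by linarith [ht.2])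
    refine abs_le.2 ⟨?_, ?_⟩
    · linarith [neg_abs_le (Real.log (1 + A)), abs_nonneg (Real.log (1 + B))]
    · linarith [le_abs_self (Real.log (1 + B)), abs_nonneg (Real.log (1 + A))]
  | succ J ih =>
    intro R hR
    obtain ⟨C, hC, h⟩ := ih (R + 1) (by linarith)
    refine ⟨R * C, by positivity, fun a ha t ht => ?_⟩
    have hsub : Set.uIcc 0 t ⊆ Set.Icc A B := Set.uIcc_subset_Icc ⟨hA0, hB⟩ ht
    have hder : ∀ u ∈ Set.uIcc 0 t, HasDerivWithinAt (fun u : ℝ => powRemainder (J + 1) a (u : ℂ))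
        (a * powRemainder J (a - 1) u) (Set.uIcc 0 t) u := by
      intro u hu
      refine (HasDerivAt.comp_ofReal (hasDerivAt_powRemainder_succ J a ?_)).hasDerivWithinAt
      refine Or.inl ?_
      have := (hsub hu).1
      simp
      linarith
    have hbd : ∀ u ∈ Set.uIcc 0 t, ‖a * powRemainder J (a - 1) u‖ ≤ R * (C * |t| ^ J) := by
      intro u hu
      rw [norm_mul]
      have h1 : ‖a - 1‖ ≤ R + 1 := (norm_sub_le _ _).trans (by simpa using ha)
      have h2 : |u| ≤ |t| := by
        have := Set.abs_sub_left_of_mem_uIcc hu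
        simpa using this
      gcongr
      exact (h (a - 1) h1 u (hsub hu)).trans (by gcongr)
    have := (convex_uIcc (0 : ℝ) t).norm_image_sub_le_of_norm_hasDerivWithin_le hder hbd
      Set.left_mem_uIcc Set.right_mem_uIcc
    simp only [ofReal_zero, powRemainder_succ_zero, sub_zero, Real.norm_eq_abs] at this
    refine this.trans (le_of_eq ?_)
    ring

lemma isPreconnected_ball_diff_countable (c : ℂ) {r : ℝ} (hr : 0 < r) {P : Set ℂ}
    (hP : P.Countable) : IsPreconnected (Metric.ball c r \ P) := by
  set e : OpenPartialHomeomorph ℂ ℂ := OpenPartialHomeomorph.univBall c r with he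
  have htar : e.target = Metric.ball c r := OpenPartialHomeomorph.univBall_target c hr
  have hsrc : e.source = Set.univ := OpenPartialHomeomorph.univBall_source c r
  have hinj : Function.Injective e := Set.injOn_univ.1 (hsrc ▸ e.injOn)
  have hQ : (e ⁻¹' P).Countable := hP.preimage_of_injOn hinj.injOn
  have hconn := (hQ.isConnected_compl_of_one_lt_rank (by simp)).isPreconnected
  have := hconn.image e (OpenPartialHomeomorph.continuous_univBall c r).continuousOn
  convert this using 1
  ext z
  constructor
  · rintro ⟨hz, hzP⟩
    rw [← htar] at hz
    exact ⟨e.symm z, by simpa [e.right_inv hz] using hzP, e.right_inv hz⟩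
  · rintro ⟨w, hw, rfl⟩
    exact ⟨htar ▸ e.map_source (by simp [hsrc]), hw⟩

/-- Identity theorem for functions analytic on a connected open set off a countable set. -/
lemma eventually_eq_of_analyticAt_off_countable {U P : Set ℂ} (hUo : IsOpen U)
    (hU : IsPreconnected U) (hP : P.Countable) {f g : ℂ → ℂ}
    (hf : ∀ z ∈ U \ P, AnalyticAt ℂ f z) (hg : ∀ z ∈ U \ P, AnalyticAt ℂ g z)
    {z₀ : ℂ} (hz₀ : z₀ ∈ U) (hfg : ∀ᶠ z in 𝓝 z₀, f z = g z) :
    ∀ z ∈ U, ∀ᶠ w in 𝓝 z, w ∉ P → f w = g w := by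
  let S : Set ℂ := {z | ∀ᶠ w in 𝓝 z, w ∉ P → f w = g w}
  have hSo : IsOpen S := isOpen_iff_mem_nhds.2 fun z hz => eventually_eventually_nhds.2 hz
  refine hU.subset_of_closure_inter_subset hSo ⟨z₀, hz₀, hfg.mono fun z h _ => h⟩ ?_
  rintro s ⟨hs, hsU⟩
  obtain ⟨r, hr, hball⟩ := Metric.isOpen_iff.1 hUo s hsU
  obtain ⟨s', hs'B, hs'S⟩ := mem_closure_iff.1 hs _ Metric.isOpen_ball (Metric.mem_ball_self hr)
  have hs'E : ∀ᶠ w in 𝓝 s', w ∉ P → f w = g w := hs'S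
  obtain ⟨N, hN, hNo, hs'N⟩ := eventually_nhds_iff.1
    (hs'E.and (Metric.isOpen_ball.mem_nhds hs'B))
  obtain ⟨y, hyN, hyP⟩ := (hP.dense_compl ℝ).inter_open_nonempty N hNo ⟨s', hs'N⟩
  have hfreq : ∃ᶠ z in 𝓝[≠] y, f z = g z := by
    rw [frequently_nhdsWithin_iff, frequently_nhds_iff]
    intro V hyV hVo
    obtain ⟨w, hw, hwP⟩ := ((hP.insert y).dense_compl ℝ).inter_open_nonempty (V ∩ N)
      (hVo.inter hNo) ⟨y, hyV, hyN⟩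
    have hwP' := not_or.1 hwP
    exact ⟨w, hw.1, (hN w hw.2).1 hwP'.2, hwP'.1⟩
  have hEq : Set.EqOn f g (Metric.ball s r \ P) :=
    AnalyticOnNhd.eqOn_of_preconnected_of_frequently_eq
      (fun z hz => hf z ⟨hball hz.1, hz.2⟩) (fun z hz => hg z ⟨hball hz.1, hz.2⟩)
      (isPreconnected_ball_diff_countable s hr hP) ⟨(hN y hyN).2, hyP⟩ hfreq
  filter_upwards [Metric.ball_mem_nhds s hr] with w hw hwP using hEq ⟨hw, hwP⟩

/-- The remainder left after subtracting the first `J` terms of the large-`v` expansion of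
`v ^ α * (v ^ β + p) ^ (-s)`. -/
noncomputable def simpleZetaRemainder (α β p : ℝ) (J : ℕ) (v : ℝ) (s : ℂ) : ℂ :=
  ((v ^ α : ℝ) : ℂ) * (((v ^ β + p : ℝ) : ℂ) ^ (-s) -
    ∑ j ∈ Finset.range J, binomCoeff (-s) j * (p : ℂ) ^ j * (v : ℂ) ^ (-((β : ℂ) * (s + j))))

lemma simpleZetaRemainder_eq (α β p : ℝ) (J : ℕ) {v : ℝ} (hv : 0 < v) (hvp : 0 < v ^ β + p)
    (s : ℂ) : simpleZetaRemainder α β p J v s =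
      ((v ^ α : ℝ) : ℂ) * (v : ℂ) ^ (-((β : ℂ) * s)) *
        powRemainder J (-s) ((p / v ^ β : ℝ) : ℂ) := by
  have hy : 0 < v ^ β := Real.rpow_pos_of_pos hv β
  have hv0 : (v : ℂ) ≠ 0 := ofReal_ne_zero.2 hv.ne'
  have hone : 0 ≤ 1 + p / v ^ β := by
    have : 1 + p / v ^ β = (v ^ β + p) / v ^ β := by field_simp
    rw [this]; positivity
  have hfac : v ^ β + p = v ^ β * (1 + p / v ^ β) := by field_simp
  have hcpow : ∀ w : ℂ, ((v ^ β : ℝ) : ℂ) ^ w = (v : ℂ) ^ ((β : ℂ) * w) := by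
    intro w
    rw [cpow_def_of_ne_zero (ofReal_ne_zero.2 hy.ne'), cpow_def_of_ne_zero hv0,
      ← ofReal_log hy.le, ← ofReal_log hv.le, Real.log_rpow hv]
    push_cast
    ring_nf
  rw [simpleZetaRemainder, powRemainder, hfac, ofReal_mul, mul_cpow_ofReal_nonneg hy.le hone,
    hcpow, mul_assoc, mul_sub ((v : ℂ) ^ _), Finset.mul_sum]
  congr 2
  · push_cast
    ring_nf
  · refine Finset.sum_congr rfl fun j _ => ?_
    have h1 : -((β : ℂ) * (s + j)) = -((β : ℂ) * s) + -((β : ℂ) * j) := by ring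
    have h2 : (v : ℂ) ^ (-((β : ℂ) * j)) = (((v ^ β : ℝ) : ℂ) ^ j)⁻¹ := by
      rw [cpow_neg, ← hcpow, cpow_natCast]
    rw [h1, cpow_add _ _ hv0, h2, ofReal_div, div_pow]
    ring

lemma norm_simpleZetaRemainder_le (α p : ℝ) {β : ℝ} (hβ : 0 < β) (J : ℕ) {v₀ : ℝ} (hv₀ : 0 < v₀)
    (hvp : 0 < v₀ ^ β + p) {R : ℝ} (hR : 0 ≤ R) :
    ∃ C : ℝ, 0 ≤ C ∧ ∀ s : ℂ, ‖s‖ ≤ R → ∀ v : ℝ, v₀ ≤ v →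
      ‖simpleZetaRemainder α β p J v s‖ ≤ C * v ^ (α - β * s.re - β * J) := by
  have hy₀ : 0 < v₀ ^ β := Real.rpow_pos_of_pos hv₀ β
  have hA : -1 < min 0 (p / v₀ ^ β) := by
    refine lt_min (by norm_num) ?_
    rw [lt_div_iff₀ hy₀]
    linarith
  obtain ⟨C, hC, h⟩ := norm_powRemainder_le hA (min_le_left _ _) (le_max_left 0 (p / v₀ ^ β)) J R hR
  refine ⟨C * |p| ^ J, by positivity, fun s hs v hv => ?_⟩
  have hvpos : 0 < v := hv₀.trans_le hv
  have hy : 0 < v ^ β := Real.rpow_pos_of_pos hvpos β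
  have hyy : v₀ ^ β ≤ v ^ β := Real.rpow_le_rpow hv₀.le hv hβ.le
  have ht : p / v ^ β ∈ Set.Icc (min 0 (p / v₀ ^ β)) (max 0 (p / v₀ ^ β)) := by
    rcases le_total 0 p with hp | hp
    · exact ⟨(min_le_left _ _).trans (by positivity),
        (div_le_div_of_nonneg_left hp hy₀ hyy).trans (le_max_right _ _)⟩
    · refine ⟨(min_le_right _ _).trans ?_,
        (div_nonpos_of_nonpos_of_nonneg hp hy.le).trans (le_max_left _ _)⟩
      have := div_le_div_of_nonneg_left (neg_nonneg.2 hp) hy₀ hyy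
      rw [neg_div, neg_div] at this
      linarith
  rw [simpleZetaRemainder_eq α β p J hvpos (by linarith) s, norm_mul, norm_mul,
    norm_cpow_eq_rpow_re_of_pos hvpos, norm_real, Real.norm_of_nonneg (by positivity)]
  refine (mul_le_mul_of_nonneg_left (h (-s) (by simpa using hs) _ ht) (by positivity)).trans
    (le_of_eq ?_)
  have h1 : (-((β : ℂ) * s)).re = -(β * s.re) := by simp
  rw [h1, ← Real.rpow_add hvpos, Real.rpow_sub hvpos, abs_div, abs_of_pos hy, div_pow,
    Real.rpow_mul hvpos.le, Real.rpow_natCast, sub_eq_add_neg]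
  ring

lemma summable_nat_add_rpow {w e : ℝ} (hw : 0 < w) (he : e < -1) :
    Summable fun n : ℕ => ((n : ℝ) + w) ^ e := by
  have h := (Real.summable_one_div_nat_add_rpow w (-e)).2 (by linarith)
  refine h.congr fun n => ?_
  have : 0 < (n : ℝ) + w := by positivity
  rw [abs_of_pos this, Real.rpow_neg this.le, one_div, inv_inv]

lemma summable_norm_simpleZetaRemainder (α : ℝ) {β p w : ℝ} (hβ : 0 < β) (hw : 0 < w)
    (hwp : 0 < w ^ β + p) (J : ℕ) {s : ℂ} (hs : (1 + α) / β - J < s.re) :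
    Summable fun n : ℕ => ‖simpleZetaRemainder α β p J (n + w) s‖ := by
  obtain ⟨C, -, h⟩ := norm_simpleZetaRemainder_le α p hβ J hw hwp (norm_nonneg s)
  have he : α - β * s.re - β * J < -1 := by
    have := mul_lt_mul_of_pos_left hs hβ
    rw [mul_sub, mul_div_cancel₀ _ hβ.ne'] at this
    linarith
  exact Summable.of_nonneg_of_le (fun _ => norm_nonneg _)
    (fun n => h s le_rfl _ (by linarith [n.cast_nonneg (α := ℝ)]))
    ((summable_nat_add_rpow hw he).mul_left C)

lemma analyticAt_tsum_simpleZetaRemainder (α : ℝ) {β p w : ℝ} (hβ : 0 < β) (hw : 0 < w)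
    (hwp : 0 < w ^ β + p) (J : ℕ) {s : ℂ} (hs : (1 + α) / β - J < s.re) :
    AnalyticAt ℂ (fun s => ∑' n : ℕ, simpleZetaRemainder α β p J (n + w) s) s := by
  obtain ⟨σ, hσ, hσs⟩ := exists_between hs
  set R : ℝ := ‖s‖ + 1 with hRdef
  have hR : 0 ≤ R := by positivity
  obtain ⟨C, hC, h⟩ := norm_simpleZetaRemainder_le α p hβ J hw hwp hR
  let D : Set ℂ := {z | ‖z‖ < R} ∩ {z | σ < z.re}
  have hDo : IsOpen D := (isOpen_lt continuous_norm continuous_const).inter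
    (isOpen_lt continuous_const continuous_re)
  have hsD : s ∈ D := ⟨by simp [hRdef], hσs⟩
  have he : α - β * σ - β * J < -1 := by
    have := mul_lt_mul_of_pos_left hσ hβ
    rw [mul_sub, mul_div_cancel₀ _ hβ.ne'] at this
    linarith
  have hpow : ∀ z ∈ D, ∀ v : ℝ, w ≤ v → v ^ (-(β * (z.re - σ))) ≤
      Real.exp (|Real.log w| * (β * (R + |σ|))) := by
    intro z hz v hv
    have hz2 : σ < z.re := hz.2
    have hq : 0 ≤ β * (z.re - σ) := mul_nonneg hβ.le (by linarith)
    refine (Real.rpow_le_rpow_of_nonpos hw hv (by linarith)).trans ?_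
    rw [Real.rpow_def_of_pos hw]
    refine Real.exp_le_exp.2 ((le_abs_self _).trans ?_)
    rw [abs_mul, abs_neg, abs_of_nonneg hq]
    have h1 : z.re ≤ R := (re_le_norm z).trans (le_of_lt hz.1)
    have h2 := neg_abs_le σ
    gcongr
    linarith
  have hbound : ∀ n : ℕ, ∀ z ∈ D, ‖simpleZetaRemainder α β p J (n + w) z‖ ≤
      C * Real.exp (|Real.log w| * (β * (R + |σ|))) * ((n : ℝ) + w) ^ (α - β * σ - β * J) := by
    intro n z hz
    have hv : w ≤ (n : ℝ) + w := by linarith [n.cast_nonneg (α := ℝ)]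
    have hvpos := hw.trans_le hv
    refine (h z (le_of_lt hz.1) _ hv).trans ?_
    have : α - β * z.re - β * J = -(β * (z.re - σ)) + (α - β * σ - β * J) := by ring
    rw [this, Real.rpow_add hvpos, mul_assoc C]
    gcongr
    exact hpow z hz _ hv
  have hdiff : ∀ n : ℕ, DifferentiableOn ℂ (simpleZetaRemainder α β p J (n + w)) D := by
    intro n
    have hvpos : 0 < (n : ℝ) + w := by positivity
    have hvp : 0 < ((n : ℝ) + w) ^ β + p := by
      have := Real.rpow_le_rpow hw.le (by linarith [n.cast_nonneg (α := ℝ)] : w ≤ (n : ℝ) + w) hβ.le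
      linarith
    refine Differentiable.differentiableOn ?_
    unfold simpleZetaRemainder
    refine (Differentiable.sub ?_ (Differentiable.fun_sum fun j _ => Differentiable.mul
      ((differentiable_binomCoeff_neg j).mul_const _) ?_)).const_mul _
    · exact differentiable_neg.const_cpow (Or.inl (ofReal_ne_zero.2 hvp.ne'))
    · exact Differentiable.const_cpow (by fun_prop) (Or.inl (ofReal_ne_zero.2 hvpos.ne'))
  exact (differentiableOn_tsum_of_summable_norm ((summable_nat_add_rpow hw he).mul_left _) hdiff hDo
    hbound).analyticAt (hDo.mem_nhds hsD)

lemma binomCoeff_neg_one (j : ℕ) : binomCoeff (-1) j = (-1) ^ j := by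
  induction j with
  | zero => simp [binomCoeff]
  | succ j ih =>
    have h1 : ((j : ℂ) + 1) ≠ 0 := by exact_mod_cast j.succ_ne_zero
    have h2 : (j.factorial : ℂ) ≠ 0 := by exact_mod_cast j.factorial_ne_zero
    have h3 : binomCoeff (-1) (j + 1) = binomCoeff (-1) j * ((-1 - j) / (j + 1)) := by
      unfold binomCoeff
      rw [Finset.prod_range_succ, Nat.factorial_succ]
      push_cast
      field_simp
    rw [h3, ih, pow_succ]
    congr 1
    field_simp
    ring

lemma tendsto_sub_mul_tsum_nat_add_rpow {w : ℝ} (hw : 0 < w) :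
    Tendsto (fun s : ℝ => (s - 1) * ∑' n : ℕ, ((n : ℝ) + w) ^ (-s)) (𝓝[>] 1) (𝓝 1) := by
  have hZ := tendsto_sub_mul_tsum_nat_rpow
  have hid : Tendsto (fun s : ℝ => s - 1) (𝓝[>] 1) (𝓝 0) := by
    have : Tendsto (fun s : ℝ => s - 1) (𝓝 1) (𝓝 (1 - 1)) := tendsto_id.sub_const 1
    rw [sub_self] at this
    exact this.mono_left nhdsWithin_le_nhds
  have hwc : Tendsto (fun s : ℝ => w ^ (-s)) (𝓝[>] 1) (𝓝 (w ^ (-1 : ℝ))) := by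
    have : Continuous fun s : ℝ => w ^ (-s) :=
      continuous_const.rpow continuous_neg fun _ => Or.inl hw.ne'
    exact (this.tendsto 1).mono_left nhdsWithin_le_nhds
  have hlow := hZ.sub (hid.mul_const (⌈w⌉₊ : ℝ))
  have hup := (hid.mul hwc).add hZ
  rw [zero_mul, sub_zero] at hlow
  rw [zero_mul, zero_add] at hup
  refine tendsto_of_tendsto_of_tendsto_of_le_of_le' hlow hup ?_ ?_
  all_goals
    filter_upwards [self_mem_nhdsWithin] with s hs
    have hs1 : 1 < s := hs
    have hsum : Summable fun n : ℕ => ((n : ℝ) + w) ^ (-s) := summable_nat_add_rpow hw (by linarith)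
    have hsumZ : Summable fun n : ℕ => 1 / (n : ℝ) ^ s := Real.summable_one_div_nat_rpow.2 hs1
  · rw [← mul_sub]
    refine mul_le_mul_of_nonneg_left ?_ (by linarith)
    rw [← hsumZ.sum_add_tsum_nat_add ⌈w⌉₊]
    have h1 : ∑ i ∈ Finset.range ⌈w⌉₊, 1 / (i : ℝ) ^ s ≤ ⌈w⌉₊ := by
      have : ∀ i ∈ Finset.range ⌈w⌉₊, 1 / (i : ℝ) ^ s ≤ 1 := by
        intro i _
        rcases i.eq_zero_or_pos with rfl | hi
        · simp [Real.zero_rpow (by linarith : s ≠ 0)]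
        · have hi1 : (1 : ℝ) ≤ i := by exact_mod_cast hi
          rw [div_le_one (by positivity)]
          exact Real.one_le_rpow hi1 (by linarith)
      simpa using Finset.sum_le_card_nsmul _ _ 1 this
    have h2 : ∑' n : ℕ, 1 / ((n + ⌈w⌉₊ : ℕ) : ℝ) ^ s ≤ ∑' n : ℕ, ((n : ℝ) + w) ^ (-s) := by
      refine Summable.tsum_le_tsum (fun n => ?_)
        ((summable_nat_add_iff (f := fun n : ℕ => 1 / (n : ℝ) ^ s) ⌈w⌉₊).2 hsumZ) hsum
      have hpos : 0 < (n : ℝ) + w := by positivity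
      rw [Real.rpow_neg hpos.le, ← one_div]
      refine one_div_le_one_div_of_le (by positivity) (Real.rpow_le_rpow hpos.le ?_ (by linarith))
      push_cast
      linarith [Nat.le_ceil w]
    linarith
  · rw [← mul_add]
    refine mul_le_mul_of_nonneg_left ?_ (by linarith)
    rw [hsum.tsum_eq_zero_add, hsumZ.tsum_eq_zero_add]
    have h2 : ∑' n : ℕ, (((n + 1 : ℕ) : ℝ) + w) ^ (-s) ≤ ∑' n : ℕ, 1 / ((n + 1 : ℕ) : ℝ) ^ s := by
      refine Summable.tsum_le_tsum (fun n => ?_)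
        ((summable_nat_add_iff (f := fun n : ℕ => ((n : ℝ) + w) ^ (-s)) 1).2 hsum)
        ((summable_nat_add_iff (f := fun n : ℕ => 1 / (n : ℝ) ^ s) 1).2 hsumZ)
      have hpos : 0 < ((n + 1 : ℕ) : ℝ) := by positivity
      rw [Real.rpow_neg (by positivity), ← one_div]
      exact one_div_le_one_div_of_le (by positivity)
        (Real.rpow_le_rpow hpos.le (by linarith) (by linarith))
    simp only [Nat.cast_zero, zero_add, Real.zero_rpow (by linarith : s ≠ 0), div_zero]
    linarith

lemma tendsto_mul_hurwitz_one_add {w : ℝ} (hw : 0 < w) {H : ℂ → ℂ}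
    (hH : ∀ s : ℂ, 1 < s.re → H s = ∑' n : ℕ, (((n : ℝ) + w : ℝ) : ℂ) ^ (-s)) :
    Tendsto (fun t : ℝ => (t : ℂ) * H (1 + t)) (𝓝[>] 0) (𝓝 1) := by
  have hadd : Tendsto (fun t : ℝ => 1 + t) (𝓝[>] 0) (𝓝[>] 1) := by
    refine tendsto_nhdsWithin_of_tendsto_nhds_of_eventually_within _ ?_ ?_
    · have : Tendsto (fun t : ℝ => 1 + t) (𝓝 0) (𝓝 (1 + 0)) := tendsto_id.const_add 1
      rw [add_zero] at this
      exact this.mono_left nhdsWithin_le_nhds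
    · filter_upwards [self_mem_nhdsWithin] with t ht
      have : (0 : ℝ) < t := ht
      exact lt_add_of_pos_right 1 this
  have h := (continuous_ofReal.tendsto 1).comp
    ((tendsto_sub_mul_tsum_nat_add_rpow hw).comp hadd)
  rw [ofReal_one] at h
  refine h.congr' ?_
  filter_upwards [self_mem_nhdsWithin] with t ht
  have ht0 : (0 : ℝ) < t := ht
  rw [hH _ (by simpa using ht0)]
  simp only [Function.comp_apply, ofReal_mul, ofReal_tsum, add_sub_cancel_left]
  congr 1
  refine tsum_congr fun n => ?_
  have hpos : 0 ≤ (n : ℝ) + w := by positivity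
  rw [ofReal_cpow hpos, ofReal_neg, ofReal_add 1, ofReal_one]

/-- The continuation of the series `∑ (n + w) ^ α * ((n + w) ^ β + p) ^ (-s)` to the half-plane
`(1 + α) / β - J < re s`, where `H` is the Hurwitz zeta function with parameter `w`. -/
noncomputable def simpleZetaExt (H : ℂ → ℂ) (α β p w : ℝ) (J : ℕ) (s : ℂ) : ℂ :=
  ∑ j ∈ Finset.range J, binomCoeff (-s) j * (p : ℂ) ^ j * H ((β : ℂ) * (s + j) - α) +
    ∑' n : ℕ, simpleZetaRemainder α β p J (n + w) s

lemma simpleZetaRemainder_succ (α β p : ℝ) (J : ℕ) {v : ℝ} (hv : 0 < v) (s : ℂ) :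
    simpleZetaRemainder α β p J v s = simpleZetaRemainder α β p (J + 1) v s +
      binomCoeff (-s) J * (p : ℂ) ^ J * (v : ℂ) ^ (-((β : ℂ) * (s + J) - α)) := by
  have hv0 : (v : ℂ) ≠ 0 := ofReal_ne_zero.2 hv.ne'
  rw [simpleZetaRemainder, simpleZetaRemainder, Finset.sum_range_succ, ofReal_cpow hv.le,
    neg_sub, sub_eq_add_neg (α : ℂ), cpow_add _ _ hv0]
  ring

section

variable {α β p w : ℝ} {H : ℂ → ℂ}

lemma simpleZetaExt_succ (hβ : 0 < β) (hw : 0 < w) (hwp : 0 < w ^ β + p)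
    (hH : ∀ s : ℂ, 1 < s.re → H s = ∑' n : ℕ, (((n : ℝ) + w : ℝ) : ℂ) ^ (-s))
    {J : ℕ} {s : ℂ} (hs : (1 + α) / β - J < s.re) :
    simpleZetaExt H α β p w (J + 1) s = simpleZetaExt H α β p w J s := by
  have hre : 1 < ((β : ℂ) * (s + J) - α).re := by
    have := mul_lt_mul_of_pos_left hs hβ
    rw [mul_sub, mul_div_cancel₀ _ hβ.ne'] at this
    simp
    linarith
  have hsum := (summable_norm_simpleZetaRemainder α hβ hw hwp J hs).of_norm
  have hsum' := (summable_norm_simpleZetaRemainder α hβ hw hwp (J + 1)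
    (by push_cast; linarith : (1 + α) / β - ((J + 1 : ℕ) : ℝ) < s.re)).of_norm
  have hdec := fun n : ℕ => simpleZetaRemainder_succ α β p J (by positivity : 0 < (n : ℝ) + w) s
  have hterm : Summable fun n : ℕ => binomCoeff (-s) J * (p : ℂ) ^ J *
      (((n : ℝ) + w : ℝ) : ℂ) ^ (-((β : ℂ) * (s + J) - α)) :=
    (hsum.sub hsum').congr fun n => by rw [hdec n]; ring
  rw [simpleZetaExt, simpleZetaExt, Finset.sum_range_succ, hH _ hre, ← tsum_mul_left,
    tsum_congr hdec, hsum'.tsum_add hterm]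
  ring

lemma simpleZetaExt_eq_of_le (hβ : 0 < β) (hw : 0 < w) (hwp : 0 < w ^ β + p)
    (hH : ∀ s : ℂ, 1 < s.re → H s = ∑' n : ℕ, (((n : ℝ) + w : ℝ) : ℂ) ^ (-s))
    {J K : ℕ} (hJK : J ≤ K) {s : ℂ} (hs : (1 + α) / β - J < s.re) :
    simpleZetaExt H α β p w K s = simpleZetaExt H α β p w J s := by
  induction K, hJK using Nat.le_induction with
  | base => rfl
  | succ K hK ih =>
    have : (J : ℝ) ≤ K := by exact_mod_cast hK
    rw [simpleZetaExt_succ hβ hw hwp hH (by linarith), ih]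

lemma simpleZetaExt_eq (hβ : 0 < β) (hw : 0 < w) (hwp : 0 < w ^ β + p)
    (hH : ∀ s : ℂ, 1 < s.re → H s = ∑' n : ℕ, (((n : ℝ) + w : ℝ) : ℂ) ^ (-s))
    {J K : ℕ} {s : ℂ} (hJ : (1 + α) / β - J < s.re) (hK : (1 + α) / β - K < s.re) :
    simpleZetaExt H α β p w J s = simpleZetaExt H α β p w K s := by
  rcases le_total J K with h | h
  · exact (simpleZetaExt_eq_of_le hβ hw hwp hH h hJ).symm
  · exact simpleZetaExt_eq_of_le hβ hw hwp hH h hK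

lemma analyticAt_hurwitz_term (hH_an : AnalyticOnNhd ℂ H {s : ℂ | s ≠ 1}) {j : ℕ} {s : ℂ}
    (hs : (β : ℂ) * (s + j) - α ≠ 1) :
    AnalyticAt ℂ (fun s => binomCoeff (-s) j * (p : ℂ) ^ j * H ((β : ℂ) * (s + j) - α)) s := by
  refine (((differentiable_binomCoeff_neg j).analyticAt s).mul analyticAt_const).mul ?_
  have h : AnalyticAt ℂ (fun s : ℂ => (β : ℂ) * (s + j) - α) s := by fun_prop
  exact AnalyticAt.fun_comp (f := fun s : ℂ => (β : ℂ) * (s + j) - α) (hH_an _ hs) h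

lemma analyticAt_simpleZetaExt (hβ : 0 < β) (hw : 0 < w) (hwp : 0 < w ^ β + p)
    (hH_an : AnalyticOnNhd ℂ H {s : ℂ | s ≠ 1}) {J : ℕ} {s : ℂ}
    (hs : (1 + α) / β - J < s.re) (hj : ∀ j < J, (β : ℂ) * (s + j) - α ≠ 1) :
    AnalyticAt ℂ (simpleZetaExt H α β p w J) s := by
  unfold simpleZetaExt
  exact (Finset.analyticAt_fun_sum _ fun j h =>
    analyticAt_hurwitz_term hH_an (hj j (Finset.mem_range.1 h))).add
    (analyticAt_tsum_simpleZetaRemainder α hβ hw hwp J hs)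

lemma tsum_simpleZetaRemainder_at_zero {J : ℕ} (hJ : 0 < J) :
    ∑' n : ℕ, simpleZetaRemainder α β p J (n + w) 0 = 0 := by
  have : ∀ n : ℕ, simpleZetaRemainder α β p J (n + w) 0 = 0 := by
    intro n
    rw [simpleZetaRemainder, Finset.sum_eq_single_of_mem 0 (Finset.mem_range.2 hJ)]
    · simp [binomCoeff_zero_right]
    · intro j _ hj
      simp [binomCoeff_zero_left (Nat.pos_of_ne_zero hj)]
  simp [this]

lemma sum_hurwitz_terms_at_zero {J : ℕ} (hJ : 0 < J) :
    ∑ j ∈ Finset.range J, binomCoeff (-0) j * (p : ℂ) ^ j * H ((β : ℂ) * (0 + j) - α) =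
      H (-(α : ℂ)) := by
  rw [Finset.sum_eq_single_of_mem 0 (Finset.mem_range.2 hJ)]
  · simp [binomCoeff_zero_right]
  · intro j _ hj
    simp [binomCoeff_zero_left (Nat.pos_of_ne_zero hj)]

/-- Any continuation agrees near a point with the explicit one, off the possible poles. -/
lemma continuation_eventually_eq (hβ : 0 < β) (hw : 0 < w) (hwp : 0 < w ^ β + p)
    (hH_an : AnalyticOnNhd ℂ H {s : ℂ | s ≠ 1})
    (hH : ∀ s : ℂ, 1 < s.re → H s = ∑' n : ℕ, (((n : ℝ) + w : ℝ) : ℂ) ^ (-s))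
    {F f : ℂ → ℂ} (hF : ∀ s : ℂ, (1 + α) / β < s.re → F s = simpleZetaExt H α β p w 0 s) {s₀ : ℂ}
    (hf : IsContinuationAt F ((1 + α) / β) s₀ f) {J : ℕ} (hJ : (1 + α) / β - J < s₀.re) :
    ∀ᶠ z in 𝓝 s₀, (∀ j : ℕ, (β : ℂ) * (z + j) - α ≠ 1) → f z = simpleZetaExt H α β p w J z := by
  obtain ⟨U, hUo, hUc, hs₀U, hsub, hfan, hfF⟩ := hf
  set c := (1 + α) / β with hc
  let P : Set ℂ := {z | ∃ j : ℕ, (β : ℂ) * (z + j) - α = 1}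
  have hP : P.Countable := by
    refine (Set.countable_range fun j : ℕ => ((1 : ℂ) + α) / β - j).mono ?_
    rintro z ⟨j, hj⟩
    refine ⟨j, ?_⟩
    have : (β : ℂ) ≠ 0 := ofReal_ne_zero.2 hβ.ne'
    simp only
    field_simp
    linear_combination -hj
  let M : ℂ → ℂ := fun s => simpleZetaExt H α β p w (⌊c - s.re⌋₊ + 1) s
  have hidx : ∀ s : ℂ, c - ((⌊c - s.re⌋₊ + 1 : ℕ) : ℝ) < s.re := by
    intro s
    have := Nat.lt_floor_add_one (c - s.re)
    push_cast
    linarith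
  have hM : ∀ (K : ℕ) (s : ℂ), c - K < s.re → M s = simpleZetaExt H α β p w K s :=
    fun K s hs => simpleZetaExt_eq hβ hw hwp hH (hidx s) hs
  have hnhds : ∀ (K : ℕ) (s : ℂ), c - K < s.re → M =ᶠ[𝓝 s] simpleZetaExt H α β p w K :=
    fun K s hs => by
      filter_upwards [(isOpen_lt continuous_const continuous_re).mem_nhds hs] with z hz
      exact hM K z hz
  have hMan : ∀ z ∈ U \ P, AnalyticAt ℂ M z := fun z hz =>
    (analyticAt_simpleZetaExt hβ hw hwp hH_an (hidx z) fun j _ h => hz.2 ⟨j, h⟩).congr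
      (hnhds _ z (hidx z)).symm
  have hz₁ : c < ((c + 1 : ℝ) : ℂ).re := by simp
  have hev : ∀ᶠ z in 𝓝 ((c + 1 : ℝ) : ℂ), f z = M z := by
    filter_upwards [(isOpen_lt continuous_const continuous_re).mem_nhds hz₁] with z hz
    have hz' : c < z.re := hz
    rw [hfF z hz', hF z hz', hM 0 z (by simpa using hz')]
  filter_upwards [eventually_eq_of_analyticAt_off_countable hUo hUc.isPreconnected hP
    (fun z hz => hfan z hz.1) hMan (hsub hz₁) hev s₀ hs₀U, hnhds J s₀ hJ] with z h1 h2 h3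
  rw [h1 fun ⟨j, hj⟩ => h3 j hj, h2]

end

/-- The limit at `0` of the expansion term in which the zero of the binomial coefficient meets the
pole of `H`. -/
lemma tendsto_hurwitz_pole_term {α β w : ℝ} (p : ℝ) (hβ : 0 < β) (hw : 0 < w) {H : ℂ → ℂ}
    (hH : ∀ s : ℂ, 1 < s.re → H s = ∑' n : ℕ, (((n : ℝ) + w : ℝ) : ℂ) ^ (-s))
    {m : ℕ} (hm : 1 + α = β * ((m + 1 : ℕ) : ℝ)) :
    Tendsto (fun t : ℝ => binomCoeff (-(t : ℂ)) (m + 1) * (p : ℂ) ^ (m + 1) *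
      H ((β : ℂ) * (t + (m + 1 : ℕ)) - α)) (𝓝[>] 0)
      (𝓝 ((((-1 : ℝ) ^ (m + 1) / (α + 1)) * p ^ (m + 1) : ℝ) : ℂ)) := by
  have hβ0 : (β : ℂ) ≠ 0 := ofReal_ne_zero.2 hβ.ne'
  have hm0 : ((m : ℂ) + 1) ≠ 0 := by exact_mod_cast m.succ_ne_zero
  have hmC : (1 : ℂ) + α = β * (m + 1) := by exact_mod_cast congrArg ((↑) : ℝ → ℂ) hm
  have hmul : Tendsto (fun t : ℝ => β * t) (𝓝[>] 0) (𝓝[>] 0) := by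
    refine tendsto_nhdsWithin_of_tendsto_nhds_of_eventually_within _ ?_ ?_
    · have : Tendsto (fun t : ℝ => β * t) (𝓝 0) (𝓝 (β * 0)) := tendsto_id.const_mul β
      rw [mul_zero] at this
      exact this.mono_left nhdsWithin_le_nhds
    · filter_upwards [self_mem_nhdsWithin] with t ht using mul_pos hβ ht
  have h1 := (tendsto_mul_hurwitz_one_add hw hH).comp hmul
  have h2 : Tendsto (fun t : ℝ => binomCoeff (-((t : ℂ) + 1)) m) (𝓝[>] 0)
      (𝓝 (binomCoeff (-(((0 : ℝ) : ℂ) + 1)) m)) := by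
    have hc : Continuous fun t : ℝ => binomCoeff (-((t : ℂ) + 1)) m :=
      (differentiable_binomCoeff_neg m).continuous.comp (continuous_ofReal.add continuous_const)
    exact (hc.tendsto 0).mono_left nhdsWithin_le_nhds
  rw [ofReal_zero, zero_add, binomCoeff_neg_one] at h2
  have h3 := (h2.mul h1).const_mul (-(p : ℂ) ^ (m + 1) / (β * (m + 1)))
  have hlim : -(p : ℂ) ^ (m + 1) / (β * (m + 1)) * ((-1) ^ m * 1) =
      ((((-1 : ℝ) ^ (m + 1) / (α + 1)) * p ^ (m + 1) : ℝ) : ℂ) := by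
    rw [← hmC]
    push_cast
    ring
  rw [hlim] at h3
  refine h3.congr fun t => ?_
  have harg : (β : ℂ) * (t + (m + 1 : ℕ)) - α = 1 + ((β * t : ℝ) : ℂ) := by
    push_cast
    linear_combination -hmC
  have hbin := binomCoeff_succ_mul (-(t : ℂ)) m
  have hbin' : binomCoeff (-(t : ℂ)) (m + 1) = -(t : ℂ) * binomCoeff (-((t : ℂ) + 1)) m / (m + 1) := by
    rw [eq_div_iff hm0, hbin]
    ring_nf
  simp only [Function.comp_apply]
  rw [harg, hbin']
  push_cast
  field_simp

lemma zSimple_summand_eq (α β x p : ℝ) (n : ℕ) (s : ℂ) :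
    ((((n : ℝ) + 1 + x) ^ α : ℝ) : ℂ) * ((((n : ℝ) + 1 + x) ^ β + p : ℝ) : ℂ) ^ (-s) =
      simpleZetaRemainder α β p 0 (n + (x + 1)) s := by
  have : (n : ℝ) + 1 + x = n + (x + 1) := by ring
  simp [simpleZetaRemainder, this]

/-- for real `α ≥ 0`, `β > 0`, `x > −1`, and `p` with `(n+x)^β + p > 0` for
all `n ≥ 1`, the series `z(s) = ∑_{n≥1} (n+x)^α ((n+x)^β + p)^{-s}` converges absolutely
for `Re s > (1+α)/β`. If `(1+α)/β` is not a positive integer, every analytic continuation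
`f` of the series to `0` satisfies `f(0) = ζ_H(−α, x+1)`; if `(1+α)/β = k` is a positive
integer, then `f(0) = ζ_H(−α, x+1) + ((−1)^k/(α+1))·p^k`.  Here `H` is the Hurwitz zeta
function `ζ_H(·, x+1)`, the analytic continuation of `∑_{n≥0} (n + x + 1)^{-s}`. -/
theorem stmt17 (α β x p : ℝ) (hα : 0 ≤ α) (hβ : 0 < β) (hx : -1 < x)
    (hp : ∀ n : ℕ, 0 < ((n : ℝ) + 1 + x) ^ β + p)
    (H : ℂ → ℂ) (hH_an : AnalyticOnNhd ℂ H {s : ℂ | s ≠ 1})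
    (hH_eq : ∀ s : ℂ, 1 < s.re →
      H s = ∑' n : ℕ, (((n : ℝ) + (x + 1) : ℝ) : ℂ) ^ (-s)) :
    (∀ s : ℂ, (1 + α) / β < s.re →
      Summable (fun n : ℕ => ‖((((n : ℝ) + 1 + x) ^ α : ℝ) : ℂ) *
        ((((n : ℝ) + 1 + x) ^ β + p : ℝ) : ℂ) ^ (-s)‖)) ∧
    ((¬ ∃ k : ℕ, 0 < k ∧ (1 + α) / β = (k : ℝ)) →
      ∀ f : ℂ → ℂ, IsContinuationAt (zSimple α β x p) ((1 + α) / β) 0 f →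
        f 0 = H (-(α : ℂ))) ∧
    (∀ k : ℕ, 0 < k → (1 + α) / β = (k : ℝ) →
      ∀ f : ℂ → ℂ, IsContinuationAt (zSimple α β x p) ((1 + α) / β) 0 f →
        f 0 = H (-(α : ℂ)) + ((((-1 : ℝ) ^ k / (α + 1)) * p ^ k : ℝ) : ℂ)) := by
  have hw : 0 < x + 1 := by linarith
  have hwp : 0 < (x + 1) ^ β + p := by
    have := hp 0
    rwa [Nat.cast_zero, zero_add, add_comm 1 x] at this
  have hβ0 : (β : ℂ) ≠ 0 := ofReal_ne_zero.2 hβ.ne'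
  have hF : ∀ s : ℂ, (1 + α) / β < s.re →
      zSimple α β x p s = simpleZetaExt H α β p (x + 1) 0 s := fun s _ => by
    simp only [zSimple, simpleZetaExt, Finset.range_zero, Finset.sum_empty, zero_add,
      zSimple_summand_eq]
  have hpole : ∀ (z : ℂ) (j : ℕ), (β : ℂ) * (z + j) - α = 1 ↔
      z = (((1 + α) / β - j : ℝ) : ℂ) := by
    intro z j
    push_cast
    constructor <;> intro h
    · field_simp
      linear_combination h
    · rw [h]
      field_simp
      ring
  refine ⟨fun s hs => ?_, fun hk f hf => ?_, fun k hk hck f hf => ?_⟩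
  · simp only [zSimple_summand_eq]
    exact summable_norm_simpleZetaRemainder α hβ hw hwp 0 (by simpa using hs)
  · obtain ⟨J, hJ⟩ := exists_nat_gt ((1 + α) / β)
    have hc : 0 < (1 + α) / β := by positivity
    have hJ0 : 0 < J := by exact_mod_cast hc.trans hJ
    have hev := (continuation_eventually_eq hβ hw hwp hH_an hH_eq hF hf
      (J := J) (by simpa using hJ)).self_of_nhds
    rw [hev fun j h => ?_, simpleZetaExt, tsum_simpleZetaRemainder_at_zero hJ0,
      sum_hurwitz_terms_at_zero hJ0, add_zero]
    rw [hpole, eq_comm, ofReal_eq_zero, sub_eq_zero] at h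
    refine hk ⟨j, ?_, h⟩
    rw [h] at hc
    exact_mod_cast hc
  · obtain ⟨m, rfl⟩ := Nat.exists_eq_succ_of_ne_zero hk.ne'
    rw [Nat.succ_eq_add_one] at hck ⊢
    have hm : 1 + α = β * ((m + 1 : ℕ) : ℝ) := by
      rw [← hck]
      field_simp
    have hJ : (1 + α) / β - ((m + 1 + 1 : ℕ) : ℝ) < (0 : ℂ).re := by
      rw [hck]
      push_cast
      simp
    have hev := continuation_eventually_eq hβ hw hwp hH_an hH_eq hF hf hJ
    obtain ⟨U, -, -, h0U, -, hfan, -⟩ := hf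
    let A : ℂ → ℂ := fun s =>
      ∑ j ∈ Finset.range (m + 1), binomCoeff (-s) j * (p : ℂ) ^ j * H ((β : ℂ) * (s + j) - α) +
        ∑' n : ℕ, simpleZetaRemainder α β p (m + 1 + 1) (n + (x + 1)) s
    have hA0 : A 0 = H (-(α : ℂ)) := by
      simp only [A]
      rw [tsum_simpleZetaRemainder_at_zero (Nat.succ_pos _),
        sum_hurwitz_terms_at_zero (Nat.succ_pos _), add_zero]
    have hAan : AnalyticAt ℂ A 0 := by
      refine (Finset.analyticAt_fun_sum _ fun j h => analyticAt_hurwitz_term hH_an ?_).add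
        (analyticAt_tsum_simpleZetaRemainder α hβ hw hwp _ hJ)
      rw [Ne, hpole, eq_comm, ofReal_eq_zero, sub_eq_zero, hck]
      exact_mod_cast (Finset.mem_range.1 h).ne'
    have hreal : Tendsto (fun t : ℝ => (t : ℂ)) (𝓝[>] 0) (𝓝 0) := by
      have := continuous_ofReal.tendsto 0
      rw [ofReal_zero] at this
      exact this.mono_left nhdsWithin_le_nhds
    have hlim := (hAan.continuousAt.tendsto.comp hreal).add
      (tendsto_hurwitz_pole_term p hβ hw hH_eq hm)
    rw [hA0] at hlim
    refine tendsto_nhds_unique ((hfan 0 h0U).continuousAt.tendsto.comp hreal)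
      (hlim.congr' ?_)
    filter_upwards [hreal.eventually hev, Ioo_mem_nhdsGT (zero_lt_one (α := ℝ))] with t ht ht01
    have hnp : ∀ j : ℕ, (β : ℂ) * ((t : ℂ) + j) - α ≠ 1 := by
      intro j h
      rw [hpole, hck, ofReal_inj] at h
      have h1 : (j : ℝ) < ((m + 1 : ℕ) : ℝ) := by linarith [ht01.1]
      have h2 : ((m + 1 : ℕ) : ℝ) < ((j + 1 : ℕ) : ℝ) := by
        push_cast at h ⊢
        linarith [ht01.2]
      have h3 := Nat.cast_lt.1 h1
      have h4 := Nat.cast_lt.1 h2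
      omega
    simp only [Function.comp_apply, A]
    rw [ht hnp, simpleZetaExt, Finset.sum_range_succ _ (m + 1)]
    ring
end
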